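/- arXiv:2512.00802 — 6 statements merged into one kernel-verified Lean document; each statement's English description precedes it below -/
import Mathlib

section
/- Let U ⊆ ℂ be a bounded domain, V its filling, ζ ∈ U, and ε > 0. Then there exists a Jordan curve γ (a continuous injective map from the unit circle into ℂ) whose image is contained in {z ∈ V : dist(z, ∂V) < ε}, such that ζ lies in a bounded connected component of the complement of the image of γ. -/
open Complex Metric Bornology

/-- The filling of a set `U ⊆ ℂ`: the union of `U` with all bounded connected
components of its complement. -/
def filling (U : Set ℂ) : Set ℂ :=
  U ∪ {z : ℂ | z ∈ Uᶜ ∧ IsBounded (connectedComponentIn Uᶜ z)}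


namespace Brick

/-- successor of a lattice vertex along the boundary of the cell set `f` (kept to the left) -/
def nx (f : ℤ → ℤ → Bool) (p : ℤ × ℤ) : ℤ × ℤ :=
  if f p.1 p.2 = true ∧ f p.1 (p.2 - 1) = false then (p.1 + 1, p.2)
  else if f (p.1 - 1) p.2 = true ∧ f p.1 p.2 = false then (p.1, p.2 + 1)
  else if f (p.1 - 1) (p.2 - 1) = true ∧ f (p.1 - 1) p.2 = false then (p.1 - 1, p.2)
  else if f p.1 (p.2 - 1) = true ∧ f (p.1 - 1) (p.2 - 1) = false then (p.1, p.2 - 1)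
  else p

/-- predecessor -/
def pv (f : ℤ → ℤ → Bool) (p : ℤ × ℤ) : ℤ × ℤ :=
  if f (p.1 - 1) p.2 = true ∧ f (p.1 - 1) (p.2 - 1) = false then (p.1 - 1, p.2)
  else if f (p.1 - 1) (p.2 - 1) = true ∧ f p.1 (p.2 - 1) = false then (p.1, p.2 - 1)
  else if f p.1 (p.2 - 1) = true ∧ f p.1 p.2 = false then (p.1 + 1, p.2)
  else if f p.1 p.2 = true ∧ f (p.1 - 1) p.2 = false then (p.1, p.2 + 1)
  else p

/-- no checkerboard vertex -/
def NoX (f : ℤ → ℤ → Bool) : Prop :=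
  ∀ a b : ℤ, f (a - 1) (b - 1) = f a (b - 1) ∨ f (a - 1) b = f a b

variable {f : ℤ → ℤ → Bool}

lemma pv_nx (hf : NoX f) (p : ℤ × ℤ) : pv f (nx f p) = p := by
  obtain ⟨a, b⟩ := p
  have h0 := hf a b
  have h1 := hf (a + 1) b
  have h2 := hf (a - 1) b
  have h3 := hf a (b + 1)
  have h4 := hf a (b - 1)
  simp only [add_sub_cancel_right] at h0 h1 h2 h3 h4
  unfold nx
  split_ifs <;> simp only [pv, add_sub_cancel_right, sub_add_cancel] <;> grind

lemma nx_pv (hf : NoX f) (p : ℤ × ℤ) : nx f (pv f p) = p := by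
  obtain ⟨a, b⟩ := p
  have h0 := hf a b
  have h1 := hf (a + 1) b
  have h2 := hf (a - 1) b
  have h3 := hf a (b + 1)
  have h4 := hf a (b - 1)
  simp only [add_sub_cancel_right] at h0 h1 h2 h3 h4
  unfold pv
  split_ifs <;> simp only [nx, add_sub_cancel_right, sub_add_cancel] <;> grind

/-- the permutation -/
def sg (hf : NoX f) : Equiv.Perm (ℤ × ℤ) := ⟨nx f, pv f, pv_nx hf, nx_pv hf⟩

lemma nx_nx (hf : NoX f) (p : ℤ × ℤ) (h : nx f p ≠ p) : nx f (nx f p) ≠ p := by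
  intro h'
  have h2 := pv_nx hf (nx f p)
  rw [h'] at h2
  obtain ⟨a, b⟩ := p
  have h0 := hf a b
  revert h2 h
  simp only [nx, pv]
  split_ifs <;> simp <;> grind

lemma nx_vert (hf : NoX f) (a b : ℤ) (h : f (a - 1) b ≠ f a b) :
    nx f (a, b) = (a, b + 1) ∨ nx f (a, b + 1) = (a, b) := by
  have h0 := hf a b
  have h1 := hf a (b + 1)
  simp only [nx, add_sub_cancel_right] at *
  grind

lemma nx_hor (hf : NoX f) (a b : ℤ) (h : f a b ≠ f a (b - 1)) :
    nx f (a, b) = (a + 1, b) ∨ nx f (a + 1, b) = (a, b) := by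
  have h0 := hf a b
  have h1 := hf (a + 1) b
  simp only [nx, add_sub_cancel_right] at *
  grind

/-- the shape of a step -/
lemma nx_step (p : ℤ × ℤ) (h : nx f p ≠ p) :
    (nx f p = (p.1 + 1, p.2) ∧ f p.1 p.2 = true ∧ f p.1 (p.2 - 1) = false) ∨
    (nx f p = (p.1, p.2 + 1) ∧ f (p.1 - 1) p.2 = true ∧ f p.1 p.2 = false) ∨
    (nx f p = (p.1 - 1, p.2) ∧ f (p.1 - 1) (p.2 - 1) = true ∧ f (p.1 - 1) p.2 = false) ∨
    (nx f p = (p.1, p.2 - 1) ∧ f p.1 (p.2 - 1) = true ∧ f (p.1 - 1) (p.2 - 1) = false) := by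
  revert h
  unfold nx
  split_ifs <;> simp_all

/-- integer value -/
def iv (f : ℤ → ℤ → Bool) (a b : ℤ) : ℤ := if f a b = true then 1 else 0

open Classical in
/-- winding number of the part `O` of the boundary around the square `(a, b)` -/
noncomputable def wd (f : ℤ → ℤ → Bool) (N : ℤ) (O : ℤ × ℤ → Prop) (a b : ℤ) : ℤ :=
  ∑ k ∈ Finset.Ico (-N) (a + 1), if O (k, b) then iv f k b - iv f (k - 1) b else 0

lemma iv_eq_iff {a b c d : ℤ} : iv f a b = iv f c d ↔ f a b = f c d := by
  unfold iv
  cases f a b <;> cases f c d <;> simp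

lemma sum_Ico_succ (g : ℤ → ℤ) (m n : ℤ) (h : m ≤ n) :
    ∑ k ∈ Finset.Ico m (n + 1), g k = ∑ k ∈ Finset.Ico m n, g k + g n := by
  rw [← Finset.insert_Ico_right_eq_Ico_add_one h, Finset.sum_insert (by simp), add_comm]

section
variable {N : ℤ} {O : ℤ × ℤ → Prop}

open Classical in
lemma wd_horizontal (hN : ∀ a b, f a b = true → -N ≤ a ∧ a < N) (a b : ℤ) :
    wd f N O a b = wd f N O (a - 1) b +
      (if O (a, b) then iv f a b - iv f (a - 1) b else 0) := by
  unfold wd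
  by_cases h : -N ≤ a
  · rw [sum_Ico_succ _ _ _ h, sub_add_cancel]
  · have h1 : iv f a b = 0 := by
      unfold iv; rw [if_neg]; intro h'; exact h (hN _ _ h').1
    have h2 : iv f (a - 1) b = 0 := by
      unfold iv; rw [if_neg]; intro h'; have := (hN _ _ h').1; omega
    rw [Finset.Ico_eq_empty (by omega), Finset.Ico_eq_empty (by omega), h1, h2]; simp

open Classical in
lemma wd_vertical (hf : NoX f) (hN : ∀ a b, f a b = true → -N ≤ a ∧ a < N)
    (hO : ∀ p, O (nx f p) ↔ O p) (a b : ℤ) :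
    wd f N O a b = wd f N O a (b - 1) +
      (if O (a + 1, b) then iv f a b - iv f a (b - 1) else 0) := by
  have hv : ∀ a b, iv f a b ≠ iv f (a - 1) b → (O (a, b) ↔ O (a, b + 1)) := by
    intro a b h
    rw [Ne, iv_eq_iff] at h
    rcases nx_vert hf a b (Ne.symm h) with h | h
    · rw [← h, hO]
    · rw [← h, hO]
  have hh : ∀ a b, iv f a b ≠ iv f a (b - 1) → (O (a, b) ↔ O (a + 1, b)) := by
    intro a b h
    rw [Ne, iv_eq_iff] at h
    rcases nx_hor hf a b h with h | h
    · rw [← h, hO]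
    · rw [← h, hO]
  have hlow : ∀ a b, a < -N → iv f a b = 0 := by
    intro a b h
    unfold iv; rw [if_neg]; intro h'; have := (hN _ _ h').1; omega
  by_cases h : a < -N
  · unfold wd
    rw [Finset.Ico_eq_empty (by omega), hlow a b h, hlow a (b-1) h]; simp
  · push Not at h
    induction a, h using Int.leInduction with
    | base =>
      rw [wd_horizontal hN, wd_horizontal hN _ (b - 1)]
      have e1 : wd f N O (-N - 1) b = 0 := by
        unfold wd; rw [Finset.Ico_eq_empty (by omega)]; simp
      have e2 : wd f N O (-N - 1) (b-1) = 0 := by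
        unfold wd; rw [Finset.Ico_eq_empty (by omega)]; simp
      have e3 := hlow (-N - 1) b (by omega)
      have e4 := hlow (-N - 1) (b - 1) (by omega)
      have h1 := hv (-N) (b - 1)
      have h2 := hh (-N) b
      rw [sub_add_cancel] at h1
      rw [e1, e2, e3, e4] at *
      grind
    | succ a ha ih =>
      rw [wd_horizontal hN, wd_horizontal hN _ (b - 1), add_sub_cancel_right, ih]
      have h1 := hv (a + 1) (b - 1)
      have h2 := hh (a + 1) b
      rw [sub_add_cancel] at h1
      rw [add_sub_cancel_right] at h1
      grind
end

end Brick

namespace Brick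
variable {f : ℤ → ℤ → Bool}

lemma wd_support {N : ℤ} {O : ℤ × ℤ → Prop} (hf : NoX f)
    (hN : ∀ a b, f a b = true → (-N ≤ a ∧ a < N) ∧ (-N ≤ b ∧ b < N))
    (hO : ∀ p, O (nx f p) ↔ O p) (a b : ℤ) (h : wd f N O a b ≠ 0) :
    (-N ≤ a ∧ a < N) ∧ (-N ≤ b ∧ b < N) := by
  have hN1 : ∀ a b, f a b = true → -N ≤ a ∧ a < N := fun a b h => (hN a b h).1
  have hb : ∀ a b, ¬ (-N ≤ b ∧ b < N) → wd f N O a b = 0 := by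
    intro a b hb
    have : ∀ k, iv f k b = 0 := by
      intro k
      unfold iv; rw [if_neg]; intro h'; exact hb (hN _ _ h').2
    unfold wd
    simp [this]
  have hbb : -N ≤ b ∧ b < N := by
    by_contra hc
    exact h (hb a b hc)
  refine ⟨⟨?_, ?_⟩, hbb⟩
  · by_contra hc
    apply h
    unfold wd
    rw [Finset.Ico_eq_empty (by omega)]; simp
  · by_contra hc
    push Not at hc
    have hi : ∀ b, iv f a b = 0 := by
      intro k
      unfold iv; rw [if_neg]; intro h'; have := (hN _ _ h').1.2; omega
    have key : ∀ b, wd f N O a b = wd f N O a (b - 1) := by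
      intro b
      rw [wd_vertical hf hN1 hO, hi, hi]; simp
    have : ∀ n : ℕ, wd f N O a (-N - 1 + n) = 0 := by
      intro n
      induction n with
      | zero => exact hb _ _ (by simp)
      | succ n ih => 
        rw [key, ← ih]; congr 1; push_cast; ring
    apply h
    have h2 := this (b - (-N - 1)).toNat
    rw [Int.toNat_of_nonneg (by omega)] at h2
    simpa using h2

lemma telescope (g : ℤ → ℤ) (m : ℤ) (n : ℕ) :
    ∑ k ∈ Finset.Ico m (m + n), (g k - g (k - 1)) = g (m + n - 1) - g (m - 1) := by
  induction n with
  | zero => simp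
  | succ n ih => 
    have : m + ((n + 1 : ℕ) : ℤ) = m + n + 1 := by push_cast; ring
    rw [this, sum_Ico_succ _ _ _ (by omega), ih, add_sub_cancel_right]; ring

lemma exists_cycle {N : ℤ} (hf : NoX f)
    (hN : ∀ a b, f a b = true → -N ≤ a ∧ a < N) (h0 : f 0 0 = true) :
    ∃ x, wd f N ((sg hf).SameCycle x) 0 0 ≠ 0 ∧ nx f x ≠ x := by
  classical
  have tot : ∑ k ∈ Finset.Ico (-N) (0 + 1), (iv f k 0 - iv f (k - 1) 0) = 1 := by
    have h1 := (hN _ _ h0).1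
    have := telescope (fun k => iv f k 0) (-N) (N + 1).toNat
    rw [Int.toNat_of_nonneg (by omega), show -N + (N + 1) = 0 + 1 by ring] at this
    rw [this]
    have e1 : iv f (-N - 1) 0 = 0 := by
      unfold iv; rw [if_neg]; intro h'; have := (hN _ _ h').1; omega
    have e2 : iv f 0 0 = 1 := by unfold iv; rw [if_pos h0]
    simp [e1, e2]
  let R : Setoid ℤ := Setoid.comap (fun k => ((k, 0) : ℤ × ℤ)) (Equiv.Perm.SameCycle.setoid (sg hf))
  rw [Finset.sum_partition R] at tot
  obtain ⟨q, hq, hq0⟩ := Finset.exists_ne_zero_of_sum_ne_zero (by rw [tot]; simp)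
  obtain ⟨k, hk, rfl⟩ := Finset.mem_image.1 hq
  have hw : wd f N ((sg hf).SameCycle (k, 0)) 0 0 ≠ 0 := by
    unfold wd
    rw [← Finset.sum_filter]
    convert hq0 using 2
    ext y
    simp only [Finset.mem_filter]
    refine and_congr_right fun _ => ?_
    rw [Quotient.eq]
    exact ⟨fun h => h.symm, fun h => Equiv.Perm.SameCycle.symm h⟩
  refine ⟨(k, 0), hw, ?_⟩
  intro hfix
  unfold wd at hw
  obtain ⟨j, hj, hj0⟩ := Finset.exists_ne_zero_of_sum_ne_zero hw
  have hs : (sg hf).SameCycle (k, 0) (j, 0) := by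
    by_contra hc; simp [hc] at hj0
  rw [if_pos hs, sub_ne_zero, Ne, iv_eq_iff] at hj0
  have hfj : nx f (j, 0) = (j, 0) := hs.apply_eq_self_iff.1 hfix
  rcases nx_vert hf j 0 (Ne.symm hj0) with h | h
  · rw [hfj] at h; simp at h
  · have := (sg hf).injective (h.trans hfj.symm)
    simp at this

lemma exists_period (hf : NoX f) {N : ℤ} 
    (hN : ∀ a b, f a b = true → (-N ≤ a ∧ a < N) ∧ (-N ≤ b ∧ b < N)) (x : ℤ × ℤ)
    (hx : nx f x ≠ x) :
    ∃ n : ℕ, 0 < n ∧ ∀ i j : ℤ, ((sg hf ^ i) x = (sg hf ^ j) x ↔ (n : ℤ) ∣ i - j) := by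
  have hfin : {p | nx f p ≠ p}.Finite := by
    apply ((Set.finite_Icc (-N) (N + 1)).prod (Set.finite_Icc (-N) (N+1))).subset
    rintro ⟨a, b⟩ hp
    have := nx_step (a, b) hp
    simp only [Set.mem_prod, Set.mem_Icc]
    rcases this with h | h | h | h <;> have := hN _ _ h.2.1 <;> simp only at this <;> omega
  have hmem : ∀ i : ℕ, (sg hf ^ i) x ∈ {p | nx f p ≠ p} := by
    intro i hi
    exact hx ((Equiv.Perm.SameCycle.apply_eq_self_iff (f := sg hf) ⟨i, by simp⟩).2 hi)
  have hper : 0 < Function.minimalPeriod (sg hf • ·) x := by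
    obtain ⟨i, j, hij, h⟩ : ∃ i j : ℕ, i < j ∧ (sg hf ^ i) x = (sg hf ^ j) x := by
      by_contra hc
      push Not at hc
      refine Set.infinite_of_injective_forall_mem (f := fun i : ℕ => (sg hf ^ i) x) ?_ hmem hfin
      intro i j hij
      rcases lt_trichotomy i j with h | h | h
      · exact absurd hij (hc _ _ h)
      · exact h
      · exact absurd hij.symm (hc _ _ h)
    apply Function.IsPeriodicPt.minimalPeriod_pos (n := j - i) (by omega)
    have : (sg hf ^ (j - i)) x = x := by
      apply (sg hf ^ i).injective
      rw [← Equiv.Perm.mul_apply, ← pow_add, h]; congr 2; omega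
    rw [Function.IsPeriodicPt, Function.IsFixedPt, smul_iterate]
    exact this
  refine ⟨_, hper, fun i j => ?_⟩
  rw [← MulAction.zpow_smul_eq_iff_minimalPeriod_dvd]
  constructor
  · intro h
    apply (sg hf ^ j).injective
    rw [Equiv.Perm.smul_def, ← Equiv.Perm.mul_apply, ← zpow_add, ← h]; congr 2; ring
  · intro h
    rw [Equiv.Perm.smul_def] at h
    conv_rhs => rw [← h]
    rw [← Equiv.Perm.mul_apply, ← zpow_add]; congr 2; ring
end Brick

namespace Brick

lemma exists_circle (g : ℝ → ℂ) (hg : Continuous g) (T : ℝ) (hT : 0 < T)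
    (hp : Function.Periodic g T) (hi : ∀ s t, g s = g t → ∃ m : ℤ, s - t = m * T) :
    ∃ γ : ℂ → ℂ, ContinuousOn γ (sphere (0 : ℂ) 1) ∧ Set.InjOn γ (sphere (0 : ℂ) 1) ∧
      γ '' sphere (0 : ℂ) 1 = Set.range g := by
  have hpi : (2 * Real.pi) ≠ 0 := by positivity
  set G : ℝ → ℂ := fun θ => g (θ * (T / (2 * Real.pi))) with hG
  have hGp : Function.Periodic G (2 * Real.pi) := by
    intro θ
    simp only [hG]
    rw [← hp (θ * _)]
    congr 1
    field_simp
  have hGc : Continuous G := by fun_prop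
  let L : Real.Angle → ℂ := hGp.lift
  have hL : Continuous L := continuous_coinduced_dom.mpr hGc
  have hLG : ∀ θ : ℝ, L (θ : Real.Angle) = G θ := fun θ => hGp.lift_coe θ
  refine ⟨fun z => L (arg z : Real.Angle), ?_, ?_, ?_⟩
  · intro z hz
    apply ContinuousAt.continuousWithinAt
    have hz0 : z ≠ 0 := by
      rintro rfl; simp at hz
    exact hL.continuousAt.comp (f := fun z : ℂ => (arg z : Real.Angle)) (continuousAt_arg_coe_angle hz0)
  · intro z hz w hw h
    simp only [hLG, hG] at h
    obtain ⟨m, hm⟩ := hi _ _ h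
    have h2 : (arg z : Real.Angle) = arg w := by
      rw [Real.Angle.angle_eq_iff_two_pi_dvd_sub]
      refine ⟨m, ?_⟩
      field_simp at hm
      linarith
    apply Complex.ext_norm_arg
    · simp at hz hw; rw [hz, hw]
    · exact arg_coe_angle_eq_iff.1 h2
  · ext y
    constructor
    · rintro ⟨z, hz, rfl⟩
      exact ⟨_, (hLG _).symm⟩
    · rintro ⟨t, rfl⟩
      refine ⟨exp ((t * (2 * Real.pi / T) : ℝ) * I), by rw [mem_sphere_zero_iff_norm, Complex.norm_exp_ofReal_mul_I], ?_⟩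
      have : (arg (exp ((t * (2 * Real.pi / T) : ℝ) * I)) : Real.Angle) = ((t * (2 * Real.pi / T) : ℝ) : Real.Angle) := by
        rw [Complex.exp_mul_I, ← Complex.ofReal_cos, ← Complex.ofReal_sin, ← Real.Angle.cos_coe,
          ← Real.Angle.sin_coe]
        exact Complex.arg_cos_add_sin_mul_I_coe_angle _
      simp only [this, hLG, hG]
      congr 1
      field_simp

/-- lattice point -/
noncomputable def pt (p : ℤ × ℤ) : ℂ := ⟨p.1, p.2⟩

/-- polygon -/
noncomputable def poly (P : ℤ → ℤ × ℤ) (t : ℝ) : ℂ :=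
  pt (P ⌊t⌋) + (Int.fract t : ℝ) • (pt (P (⌊t⌋ + 1)) - pt (P ⌊t⌋))

lemma poly_of_mem (P : ℤ → ℤ × ℤ) (k : ℤ) (t : ℝ) (h0 : 0 ≤ t) (h1 : t ≤ 1) :
    poly P (k + t) = pt (P k) + t • (pt (P (k + 1)) - pt (P k)) := by
  rcases h1.lt_or_eq with h | h
  · have : ⌊(k : ℝ) + t⌋ = k := by
      rw [Int.floor_eq_iff]; constructor <;> linarith
    unfold poly
    rw [Int.fract, this]; simp
  · subst h
    have : ⌊(k : ℝ) + 1⌋ = k + 1 := by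
      rw [Int.floor_eq_iff]; push_cast; constructor <;> linarith
    unfold poly
    rw [Int.fract, this]; simp

lemma poly_cont (P : ℤ → ℤ × ℤ) : Continuous (poly P) := by
  rw [continuous_iff_continuousAt]
  intro t
  set k := ⌊t⌋ with hk
  let F : ℝ → ℂ := fun s => pt (P k) + (max (s - k) 0) • (pt (P (k + 1)) - pt (P k)) +
    (min (s - k) 0) • (pt (P k) - pt (P (k - 1)))
  have hF : Continuous F := by fun_prop
  have hn : Set.Ioo ((k : ℝ) - 1) (k + 1) ∈ nhds t := by
    apply Ioo_mem_nhds
    · have := Int.floor_le t; linarith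
    · exact Int.lt_floor_add_one t
  refine hF.continuousAt.congr ?_
  filter_upwards [hn] with s hs
  rcases le_total (k : ℝ) s with h | h
  · have := poly_of_mem P k (s - k) (by linarith) (by linarith [hs.2])
    rw [add_sub_cancel] at this
    rw [this]
    simp only [F]
    rw [max_eq_left (by linarith), min_eq_right (by linarith)]; simp
  · have := poly_of_mem P (k - 1) (s - k + 1) (by linarith [hs.1]) (by linarith)
    rw [show ((k - 1 : ℤ) : ℝ) + (s - k + 1) = s by push_cast; ring, sub_add_cancel] at this
    rw [this]
    simp only [F]
    rw [max_eq_right (by linarith), min_eq_left (by linarith)]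
    simp only [Complex.real_smul]; push_cast; ring

/-- `q` is one of the four lattice neighbours of `p` -/
def Nb (p q : ℤ × ℤ) : Prop :=
  q = (p.1 + 1, p.2) ∨ q = (p.1, p.2 + 1) ∨ q = (p.1 - 1, p.2) ∨ q = (p.1, p.2 - 1)

lemma int_aux {a b : ℤ} {s : ℝ} (h0 : 0 ≤ s) (h1 : s < 1) (h : (a : ℝ) + s = b) : a = b ∧ s = 0 := by
  have h2 : a ≤ b := by
    have : (a : ℝ) ≤ b := by linarith
    exact_mod_cast this
  have h3 : b < a + 1 := by
    have : (b : ℝ) < a + 1 := by linarith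
    exact_mod_cast this
  have : a = b := by omega
  subst this
  exact ⟨rfl, by linarith⟩

lemma int_aux1 {a b : ℤ} {s t : ℝ} (h0 : 0 ≤ s) (h1 : s < 1) (h0' : 0 ≤ t) (h1' : t < 1)
    (h : (a : ℝ) + s = b + t) : a = b ∧ s = t := by
  have h2 : a < b + 1 := by
    have : (a : ℝ) < b + 1 := by linarith
    exact_mod_cast this
  have h3 : b < a + 1 := by
    have : (b : ℝ) < a + 1 := by linarith
    exact_mod_cast this
  have : a = b := by omega
  subst this
  exact ⟨rfl, by linarith⟩

lemma int_aux2 {a b : ℤ} {s t : ℝ} (h0 : 0 ≤ s) (h1 : s < 1) (h0' : 0 ≤ t) (h1' : t < 1)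
    (h : (a : ℝ) + s = b - t) : (a = b ∧ s = 0 ∧ t = 0) ∨ b = a + 1 := by
  have h2 : a ≤ b := by
    have : (a : ℝ) ≤ b := by linarith
    exact_mod_cast this
  have h3 : b < a + 2 := by
    have : (b : ℝ) < a + 2 := by linarith
    exact_mod_cast this
  by_cases hb : b = a + 1
  · exact Or.inr hb
  have : a = b := by omega
  subst this
  exact Or.inl ⟨rfl, by linarith, by linarith⟩

lemma edge_inj {p p' q q' : ℤ × ℤ} (hp : Nb p p') (hq : Nb q q') (hn : ¬ (p' = q ∧ q' = p))
    (hpq : p = q → p' = q')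
    {s t : ℝ} (h0 : 0 ≤ s) (h1 : s < 1) (h0' : 0 ≤ t) (h1' : t < 1)
    (h : pt p + s • (pt p' - pt p) = pt q + t • (pt q' - pt q)) : p = q ∧ s = t := by
  obtain ⟨a, b⟩ := p
  obtain ⟨c, d⟩ := q
  have hre := congrArg Complex.re h
  have him := congrArg Complex.im h
  rcases hp with rfl | rfl | rfl | rfl <;> rcases hq with rfl | rfl | rfl | rfl <;>
    simp [pt] at hre him hn hpq ⊢
  · have := int_aux1 h0 h1 h0' h1' hre
    exact ⟨⟨this.1, him⟩, this.2⟩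
  · have u := int_aux h0 h1 hre
    have v := int_aux h0' h1' him.symm
    exact ⟨⟨u.1, v.1.symm⟩, by rw [u.2, v.2]⟩
  · rcases int_aux2 h0 h1 h0' h1' (show (a : ℝ) + s = c - t by linarith) with h | h
    · exact ⟨⟨h.1, him⟩, by rw [h.2.1, h.2.2]⟩
    · omega
  · have u := int_aux h0 h1 hre
    have v := int_aux h0' h1' (show (b : ℝ) + t = d by linarith)
    exact ⟨⟨u.1, v.1⟩, by rw [u.2, v.2]⟩
  · have u := int_aux h0 h1 him
    have v := int_aux h0' h1' hre.symm
    exact ⟨⟨v.1.symm, u.1⟩, by rw [u.2, v.2]⟩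
  · have := int_aux1 h0 h1 h0' h1' him
    exact ⟨⟨hre, this.1⟩, this.2⟩
  · have u := int_aux h0 h1 him
    have v := int_aux h0' h1' (show (a : ℝ) + t = c by linarith)
    exact ⟨⟨v.1, u.1⟩, by rw [u.2, v.2]⟩
  · rcases int_aux2 h0 h1 h0' h1' (show (b : ℝ) + s = d - t by linarith) with h | h
    · exact ⟨⟨hre, h.1⟩, by rw [h.2.1, h.2.2]⟩
    · omega
  · rcases int_aux2 h0' h1' h0 h1 (show (c : ℝ) + t = a - s by linarith) with h | h
    · exact ⟨⟨h.1.symm, him⟩, by rw [h.2.1, h.2.2]⟩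
    · omega
  · have u := int_aux h0 h1 (show (c : ℝ) + s = a by linarith)
    have v := int_aux h0' h1' him.symm
    exact ⟨⟨u.1.symm, v.1.symm⟩, by rw [u.2, v.2]⟩
  · have := int_aux1 h0 h1 h0' h1' (show (c : ℝ) + s = a + t by linarith)
    exact ⟨⟨this.1.symm, him⟩, this.2⟩
  · have u := int_aux h0 h1 (show (c : ℝ) + s = a by linarith)
    have v := int_aux h0' h1' (show (b : ℝ) + t = d by linarith)
    exact ⟨⟨u.1.symm, v.1⟩, by rw [u.2, v.2]⟩
  · have u := int_aux h0 h1 (show (d : ℝ) + s = b by linarith)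
    have v := int_aux h0' h1' hre.symm
    exact ⟨⟨v.1.symm, u.1.symm⟩, by rw [u.2, v.2]⟩
  · rcases int_aux2 h0' h1' h0 h1 (show (d : ℝ) + t = b - s by linarith) with h | h
    · exact ⟨⟨hre, h.1.symm⟩, by rw [h.2.1, h.2.2]⟩
    · omega
  · have u := int_aux h0 h1 (show (d : ℝ) + s = b by linarith)
    have v := int_aux h0' h1' (show (a : ℝ) + t = c by linarith)
    exact ⟨⟨v.1, u.1.symm⟩, by rw [u.2, v.2]⟩
  · have := int_aux1 h0 h1 h0' h1' (show (d : ℝ) + s = b + t by linarith)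
    exact ⟨⟨hre, this.1.symm⟩, this.2⟩

lemma exists_polygon (P : ℤ → ℤ × ℤ) (n : ℕ) (hn : 0 < n)
    (hP : ∀ i j : ℤ, P i = P j ↔ (n : ℤ) ∣ i - j) (hnb : ∀ i, Nb (P i) (P (i + 1)))
    (h2 : ∀ i, P (i + 2) ≠ P i) :
    ∃ γ : ℂ → ℂ, ContinuousOn γ (sphere (0 : ℂ) 1) ∧ Set.InjOn γ (sphere (0 : ℂ) 1) ∧
      γ '' sphere (0 : ℂ) 1 = Set.range (poly P) := by
  have hsucc : ∀ i j, P i = P j → P (i + 1) = P (j + 1) := by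
    intro i j h
    rw [hP] at h ⊢
    simpa using h
  apply exists_circle (poly P) (poly_cont P) n (by exact_mod_cast hn)
  · intro t
    have e1 : ⌊t + (n : ℝ)⌋ = ⌊t⌋ + n := Int.floor_add_natCast t n
    have e2 : P (⌊t⌋ + n) = P ⌊t⌋ := by rw [hP]; simp
    have e3 := hsucc _ _ e2
    unfold poly
    rw [e1, e2, e3, Int.fract_add_natCast]
  · intro s t h
    have := edge_inj (hnb ⌊s⌋) (hnb ⌊t⌋) ?_ (hsucc _ _) (Int.fract_nonneg s) (Int.fract_lt_one s)
      (Int.fract_nonneg t) (Int.fract_lt_one t) h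
    · obtain ⟨h3, h4⟩ := this
      rw [hP] at h3
      obtain ⟨m, hm⟩ := h3
      refine ⟨m, ?_⟩
      have hm' : ((⌊s⌋ : ℤ) : ℝ) - ⌊t⌋ = n * m := by exact_mod_cast hm
      rw [← Int.floor_add_fract s, ← Int.floor_add_fract t, h4]
      linarith
    · rintro ⟨h3, h4⟩
      have := hsucc _ _ h3
      rw [h4] at this
      exact h2 _ (by rw [← this]; congr 1; ring)
end Brick

namespace Brick

/-- left end of the brick containing the square `(a, b)` -/
def lft (a b : ℤ) : ℤ := if Even (a + b) then a else a - 1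

/-- the brick containing the square `(a, b)` -/
def brick (a b : ℤ) : Set ℂ :=
  {z | (lft a b : ℝ) ≤ z.re ∧ z.re ≤ lft a b + 2 ∧ (b : ℝ) ≤ z.im ∧ z.im ≤ b + 1}

lemma lft_le (a b : ℤ) : lft a b ≤ a ∧ a + 1 ≤ lft a b + 2 := by
  unfold lft; split_ifs <;> omega

lemma mem_brick {a b : ℤ} {z : ℂ} (h1 : (a : ℝ) ≤ z.re) (h2 : z.re ≤ a + 1)
    (h3 : (b : ℝ) ≤ z.im) (h4 : z.im ≤ b + 1) : z ∈ brick a b := by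
  have := lft_le a b
  have e1 : (lft a b : ℝ) ≤ a := by exact_mod_cast this.1
  have e2 : (a : ℝ) + 1 ≤ lft a b + 2 := by exact_mod_cast this.2
  exact ⟨by linarith, by linarith, h3, h4⟩

lemma dist_brick {a b : ℤ} {z w : ℂ} (hz : z ∈ brick a b) (hw : w ∈ brick a b) :
    dist z w ≤ 3 := by
  obtain ⟨h1, h2, h3, h4⟩ := hz
  obtain ⟨k1, k2, k3, k4⟩ := hw
  rw [dist_eq_norm]
  refine (Complex.norm_le_abs_re_add_abs_im _).trans ?_
  rw [sub_re, sub_im]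
  have : |z.re - w.re| ≤ 2 := abs_le.2 ⟨by linarith, by linarith⟩
  have : |z.im - w.im| ≤ 1 := abs_le.2 ⟨by linarith, by linarith⟩
  linarith

open Classical in
/-- indicator of the bricks inside `V` -/
noncomputable def ind (V : Set ℂ) (a b : ℤ) : Bool := decide (brick a b ⊆ V)

lemma ind_noX (V : Set ℂ) : NoX (ind V) := by
  intro a b
  have key : ∀ a b a', lft a b = lft a' b → ind V a b = ind V a' b := by
    intro a b a' h
    unfold ind brick
    rw [h]
  by_cases h : Even (a + b)
  · left
    apply key
    have h1 : Even (a - 1 + (b - 1)) := by grind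
    have h2 : ¬ Even (a + (b - 1)) := by grind
    simp [lft, h1, h2]
  · right
    apply key
    have h1 : Even (a - 1 + b) := by grind
    simp [lft, h, h1]

lemma core (V : Set ℂ) (hVb : IsBounded V) (hball : ball (⟨1/2, 1/2⟩ : ℂ) 4 ⊆ V) :
    ∃ γ : ℂ → ℂ, ContinuousOn γ (sphere (0 : ℂ) 1) ∧ Set.InjOn γ (sphere (0 : ℂ) 1) ∧
      (∀ z ∈ γ '' sphere (0 : ℂ) 1, z ∈ V ∧ ∃ w, w ∉ V ∧ dist z w ≤ 3) ∧
      ∀ T : Set ℂ, IsPreconnected T → T ⊆ (γ '' sphere (0 : ℂ) 1)ᶜ → (⟨1/2, 1/2⟩ : ℂ) ∈ T →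
        IsBounded T := by
  set f := ind V with hfdef
  have hf : NoX f := ind_noX V
  have ftrue : ∀ a b, f a b = true ↔ brick a b ⊆ V := by
    intro a b; simp [hfdef, ind]
  have ffalse : ∀ a b, f a b = false ↔ ¬ brick a b ⊆ V := by
    intro a b; simp [hfdef, ind]
  obtain ⟨N, hN⟩ : ∃ N : ℤ, ∀ a b, f a b = true → (-N ≤ a ∧ a < N) ∧ (-N ≤ b ∧ b < N) := by
    obtain ⟨R, hR⟩ := hVb.exists_norm_le
    refine ⟨⌈R⌉ + 1, fun a b h => ?_⟩
    have hm : (⟨a, b⟩ : ℂ) ∈ V := (ftrue a b).1 h (mem_brick (by simp) (by simp) (by simp) (by simp))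
    have h1 := hR _ hm
    have h2 := (Complex.abs_re_le_norm _).trans h1
    have h3 := (Complex.abs_im_le_norm _).trans h1
    simp only at h2 h3
    rw [abs_le] at h2 h3
    have hc := Int.le_ceil R
    have e1 : -⌈R⌉ ≤ a := by
      have : (-⌈R⌉ : ℝ) ≤ a := by linarith [h2.1]
      exact_mod_cast this
    have e2 : a ≤ ⌈R⌉ := by
      have : (a : ℝ) ≤ ⌈R⌉ := by linarith [h2.2]
      exact_mod_cast this
    have e3 : -⌈R⌉ ≤ b := by
      have : (-⌈R⌉ : ℝ) ≤ b := by linarith [h3.1]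
      exact_mod_cast this
    have e4 : b ≤ ⌈R⌉ := by
      have : (b : ℝ) ≤ ⌈R⌉ := by linarith [h3.2]
      exact_mod_cast this
    omega
  have hN1 : ∀ a b, f a b = true → -N ≤ a ∧ a < N := fun a b h => (hN a b h).1
  have h00 : f 0 0 = true := by
    rw [ftrue]
    refine Set.Subset.trans (fun z hz => ?_) hball
    rw [mem_ball]
    refine lt_of_le_of_lt (dist_brick hz (mem_brick ?_ ?_ ?_ ?_)) (by norm_num) <;> norm_num
  obtain ⟨x, hw, hx⟩ := exists_cycle hf hN1 h00
  obtain ⟨n, hn, hP⟩ := exists_period hf hN x hx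
  set O : ℤ × ℤ → Prop := (sg hf).SameCycle x with hO
  have hOinv : ∀ p, O (nx f p) ↔ O p := fun p => Equiv.Perm.sameCycle_apply_right (f := sg hf)
  set P : ℤ → ℤ × ℤ := fun i => (sg hf ^ i) x with hPdef
  have hPs : ∀ i, P (i + 1) = nx f (P i) := by
    intro i
    simp only [hPdef]
    rw [add_comm, zpow_add, zpow_one]; rfl
  have hPO : ∀ i, O (P i) := fun i => ⟨i, rfl⟩
  have hPn : ∀ i, nx f (P i) ≠ P i := by
    intro i hi
    exact hx ((Equiv.Perm.SameCycle.apply_eq_self_iff (hPO i)).2 hi)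
  obtain ⟨γ, hγc, hγi, hγ⟩ := exists_polygon P n hn hP
    (by
      intro i
      rw [hPs]
      rcases nx_step _ (hPn i) with h | h | h | h
      · exact Or.inl h.1
      · exact Or.inr (Or.inl h.1)
      · exact Or.inr (Or.inr (Or.inl h.1))
      · exact Or.inr (Or.inr (Or.inr h.1)))
    (by
      intro i
      rw [show i + 2 = i + 1 + 1 by ring, hPs, hPs]
      exact nx_nx hf _ (hPn i))
  have hedge : ∀ p, O p → ∀ s : ℝ, 0 ≤ s → s ≤ 1 →
      pt p + s • (pt (nx f p) - pt p) ∈ Set.range (poly P) := by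
    rintro p ⟨k, rfl⟩ s h0 h1
    refine ⟨k + s, ?_⟩
    rw [poly_of_mem P k s h0 h1, hPs]
  have hV : ∀ (z : ℂ) (k b : ℤ), z.re = k → (b : ℝ) ≤ z.im → z.im ≤ b + 1 →
      z ∉ Set.range (poly P) → wd f N O k b = wd f N O (k - 1) b := by
    intro z k b h1 h2 h3 h4
    rw [wd_horizontal hN1]
    by_contra hc
    have hk : O (k, b) := by
      by_contra hc'; simp [hc'] at hc
    rw [if_pos hk, add_eq_left, sub_eq_zero, iv_eq_iff] at hc
    rcases nx_vert hf k b (Ne.symm hc) with h | h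
    · have := hedge _ hk (z.im - b) (by linarith) (by linarith)
      rw [h] at this
      apply h4
      convert this using 1
      apply Complex.ext <;> simp [pt, h1]
    · have hk' : O (k, b + 1) := by rwa [← h, hOinv] at hk
      have := hedge _ hk' (b + 1 - z.im) (by linarith) (by linarith)
      rw [h] at this
      apply h4
      convert this using 1
      apply Complex.ext <;> simp [pt, h1]
  have hH : ∀ (z : ℂ) (a b : ℤ), z.im = b → (a : ℝ) ≤ z.re → z.re ≤ a + 1 →
      z ∉ Set.range (poly P) → wd f N O a b = wd f N O a (b - 1) := by
    intro z a b h1 h2 h3 h4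
    rw [wd_vertical hf hN1 hOinv]
    by_contra hc
    have hk : O (a + 1, b) := by
      by_contra hc'; simp [hc'] at hc
    rw [if_pos hk, add_eq_left, sub_eq_zero, iv_eq_iff] at hc
    rcases nx_hor hf a b hc with h | h
    · have hk' : O (a, b) := by rwa [← h, hOinv] at hk
      have := hedge _ hk' (z.re - a) (by linarith) (by linarith)
      rw [h] at this
      apply h4
      convert this using 1
      apply Complex.ext <;> simp [pt, h1]
    · have := hedge _ hk (a + 1 - z.re) (by linarith) (by linarith)
      rw [h] at this
      apply h4
      convert this using 1
      apply Complex.ext <;> simp [pt, h1]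
  let W : ℂ → ℤ := fun z => wd f N O ⌊z.re⌋ ⌊z.im⌋
  have hloc : ∀ z, z ∉ Set.range (poly P) → ContinuousAt W z := by
    intro z hz
    have floor_aux : ∀ u : ℝ, ∀ᶠ v in nhds u, ⌊v⌋ = ⌊u⌋ ∨ (u = ⌊u⌋ ∧ ⌊v⌋ = ⌊u⌋ - 1) := by
      intro u
      have hn : Set.Ioo ((⌈u⌉ : ℝ) - 1) (⌊u⌋ + 1) ∈ nhds u := by
        apply Ioo_mem_nhds
        · have := Int.ceil_lt_add_one u; linarith
        · exact Int.lt_floor_add_one u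
      filter_upwards [hn] with v hv
      have h1 : ⌈u⌉ - 1 ≤ ⌊v⌋ := by
        rw [Int.le_floor]; push_cast; exact hv.1.le
      have h2 : ⌊v⌋ < ⌊u⌋ + 1 := by
        rw [Int.floor_lt]; push_cast; exact hv.2
      by_cases h : ⌊v⌋ = ⌊u⌋
      · exact Or.inl h
      · right
        have h3 : ⌈u⌉ ≤ ⌊u⌋ := by omega
        have h4 : ⌊u⌋ ≤ ⌈u⌉ := Int.floor_le_ceil u
        refine ⟨le_antisymm ((Int.le_ceil u).trans (by exact_mod_cast h3)) (Int.floor_le u), ?_⟩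
        omega
    have ev1 := (Complex.continuous_re.continuousAt (x := z)).eventually (floor_aux z.re)
    have ev2 := (Complex.continuous_im.continuousAt (x := z)).eventually (floor_aux z.im)
    have : W =ᶠ[nhds z] fun _ => W z := by
      filter_upwards [ev1, ev2] with w h1 h2
      have hi : (⌊w.im⌋ : ℝ) ≤ z.im ∧ z.im ≤ ⌊w.im⌋ + 1 := by
        have a1 := Int.floor_le z.im
        have a2 := Int.lt_floor_add_one z.im
        rcases h2 with h | ⟨h, h'⟩
        · rw [h]; exact ⟨a1, a2.le⟩
        · rw [h']; push_cast; constructor <;> linarith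
      have s1 : wd f N O ⌊w.re⌋ ⌊w.im⌋ = wd f N O ⌊z.re⌋ ⌊w.im⌋ := by
        rcases h1 with h | ⟨h, h'⟩
        · rw [h]
        · rw [h']; exact (hV z _ _ h hi.1 hi.2 hz).symm
      have s2 : wd f N O ⌊z.re⌋ ⌊w.im⌋ = wd f N O ⌊z.re⌋ ⌊z.im⌋ := by
        rcases h2 with h | ⟨h, h'⟩
        · rw [h]
        · rw [h']
          exact (hH z _ _ h (Int.floor_le _) (Int.lt_floor_add_one _).le hz).symm
      exact s1.trans s2
    exact continuousAt_const.congr this.symm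
  refine ⟨γ, hγc, hγi, ?_, ?_⟩
  · rw [hγ]
    rintro _ ⟨t, rfl⟩
    have key : ∀ a b a' b', f a b = true → f a' b' = false → poly P t ∈ brick a b →
        poly P t ∈ brick a' b' → poly P t ∈ V ∧ ∃ w, w ∉ V ∧ dist (poly P t) w ≤ 3 := by
      intro a b a' b' h1 h2 h3 h4
      rw [ftrue] at h1
      rw [ffalse, Set.not_subset] at h2
      obtain ⟨w, hw, hwV⟩ := h2
      exact ⟨h1 h3, w, hwV, dist_brick h4 hw⟩
    have f0 := Int.fract_nonneg t
    have f1 := (Int.fract_lt_one t).le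
    rcases nx_step _ (hPn ⌊t⌋) with ⟨h1, h2, h3⟩ | ⟨h1, h2, h3⟩ | ⟨h1, h2, h3⟩ | ⟨h1, h2, h3⟩ <;>
      refine key _ _ _ _ h2 h3 (mem_brick ?_ ?_ ?_ ?_) (mem_brick ?_ ?_ ?_ ?_) <;>
      simp only [poly, hPs, h1, pt, add_re, add_im, sub_re, sub_im, smul_re, smul_im, smul_eq_mul] <;>
      push_cast <;> nlinarith
  · intro T hT hTs hcT
    rw [hγ] at hTs
    have hWc : ContinuousOn W T := fun z hz => (hloc z (hTs hz)).continuousWithinAt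
    have hWcc : W ⟨1/2, 1/2⟩ ≠ 0 := by
      have : ⌊(1/2 : ℝ)⌋ = 0 := by norm_num
      simp only [W, this]
      exact hw
    rw [isBounded_iff_forall_norm_le]
    refine ⟨2 * (N + 1), fun z hz => ?_⟩
    have h1 : W z ≠ 0 := by rw [hT.constant hWc hz hcT]; exact hWcc
    obtain ⟨⟨a1, a2⟩, b1, b2⟩ := wd_support hf hN hOinv _ _ h1
    have a1' : (-N : ℝ) ≤ ⌊z.re⌋ := by exact_mod_cast a1
    have a2' : (⌊z.re⌋ : ℝ) ≤ N := by exact_mod_cast a2.le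
    have b1' : (-N : ℝ) ≤ ⌊z.im⌋ := by exact_mod_cast b1
    have b2' : (⌊z.im⌋ : ℝ) ≤ N := by exact_mod_cast b2.le
    have := Int.floor_le z.re
    have := Int.lt_floor_add_one z.re
    have := Int.floor_le z.im
    have := Int.lt_floor_add_one z.im
    refine (Complex.norm_le_abs_re_add_abs_im _).trans ?_
    have : |z.re| ≤ N + 1 := abs_le.2 ⟨by linarith, by linarith⟩
    have : |z.im| ≤ N + 1 := abs_le.2 ⟨by linarith, by linarith⟩
    linarith

lemma infDist_frontier_le {V : Set ℂ} {z w : ℂ} (hz : z ∈ V) (hw : w ∉ V) :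
    infDist z (frontier V) ≤ dist z w := by
  have hs : IsPreconnected (segment ℝ z w) := (convex_segment z w).isPreconnected
  obtain ⟨y, hy, hyf⟩ : (segment ℝ z w ∩ frontier V).Nonempty := by
    rw [Set.nonempty_iff_ne_empty]
    intro he
    have hcov : segment ℝ z w ⊆ interior V ∪ interior Vᶜ := by
      intro y hy
      by_contra hc
      have : y ∈ segment ℝ z w ∩ frontier V := by
        refine ⟨hy, ?_⟩
        rw [interior_compl] at hc
        simp only [Set.mem_union, not_or, Set.mem_compl_iff, not_not] at hc
        exact ⟨hc.2, hc.1⟩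
      rw [he] at this; exact this
    have hdis : segment ℝ z w ∩ (interior V ∩ interior Vᶜ) = ∅ := by
      rw [Set.eq_empty_iff_forall_notMem]
      rintro y ⟨-, h1, h2⟩
      exact interior_subset h2 (interior_subset h1)
    rcases isPreconnected_iff_subset_of_disjoint.1 hs (interior V) (interior Vᶜ)
      isOpen_interior isOpen_interior hcov hdis with h | h
    · exact hw (interior_subset (h (right_mem_segment ℝ z w)))
    · exact interior_subset (h (left_mem_segment ℝ z w)) hz
  refine (infDist_le_dist_of_mem hyf).trans ?_
  have := dist_add_dist_of_mem_segment hy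
  linarith [dist_nonneg (x := y) (y := w)]

end Brick




lemma Brick.filling_bounded {U : Set ℂ} (hUb : IsBounded U) : IsBounded (filling U) := by
  obtain ⟨R, hR⟩ := hUb.exists_norm_le
  rw [isBounded_iff_forall_norm_le]
  refine ⟨max R 0, fun z hz => ?_⟩
  rcases hz with hz | ⟨hz, hb⟩
  · exact (hR z hz).trans (le_max_left _ _)
  · by_contra hc
    push Not at hc
    rw [max_lt_iff] at hc
    obtain ⟨M, hM⟩ := hb.exists_norm_le
    have hpre : IsPreconnected ((fun r : ℝ => (r : ℂ) * z) '' Set.Ici 1) :=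
      isPreconnected_Ici.image _ (by fun_prop)
    have hsub := hpre.subset_connectedComponentIn (F := Uᶜ) (x := z) ⟨1, by simp, by simp⟩ (by
      rintro _ ⟨r, hr, rfl⟩ hU
      have h1 := hR _ hU
      have hr' : (1 : ℝ) ≤ r := hr
      simp only [norm_mul, Complex.norm_real, Real.norm_eq_abs] at h1
      rw [abs_of_nonneg (by linarith)] at h1
      nlinarith)
    set r : ℝ := max 1 ((M + 1) / ‖z‖) with hr
    have h1 := hM _ (hsub ⟨r, Set.mem_Ici.2 (le_max_left _ _), rfl⟩)
    simp only [norm_mul, Complex.norm_real, Real.norm_eq_abs] at h1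
    have hr0 : (1 : ℝ) ≤ r := le_max_left _ _
    rw [abs_of_nonneg (by linarith)] at h1
    have h2 : (M + 1) / ‖z‖ ≤ r := le_max_right _ _
    rw [div_le_iff₀ hc.2] at h2
    linarith

theorem exists_jordan_curve_near_outer_boundary (U : Set ℂ) (hUo : IsOpen U)
    (hUc : IsConnected U) (hUb : IsBounded U) (ζ : ℂ) (hζ : ζ ∈ U)
    (ε : ℝ) (hε : 0 < ε) :
    ∃ γ : ℂ → ℂ, ContinuousOn γ (sphere (0 : ℂ) 1) ∧
      Set.InjOn γ (sphere (0 : ℂ) 1) ∧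
      γ '' sphere (0 : ℂ) 1 ⊆
        {z : ℂ | z ∈ filling U ∧ infDist z (frontier (filling U)) < ε} ∧
      ζ ∈ (γ '' sphere (0 : ℂ) 1)ᶜ ∧
      IsBounded (connectedComponentIn (γ '' sphere (0 : ℂ) 1)ᶜ ζ) := by
  obtain ⟨r, hr, hrU⟩ := Metric.isOpen_iff.1 hUo ζ hζ
  have hUV : U ⊆ filling U := Set.subset_union_left
  obtain ⟨M, hM⟩ := (Brick.filling_bounded hUb).exists_norm_le
  set V := filling U
  obtain ⟨δ, hδ, hδr, hδε⟩ : ∃ δ : ℝ, 0 < δ ∧ δ * 4 ≤ r ∧ δ * 3 < ε := by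
    refine ⟨min (r / 4) (ε / 4), by positivity, ?_, ?_⟩
    · have := min_le_left (r / 4) (ε / 4); linarith
    · have := min_le_right (r / 4) (ε / 4); linarith
  have hδ0 : (δ : ℂ) ≠ 0 := by exact_mod_cast hδ.ne'
  set c : ℂ := ⟨1/2, 1/2⟩ with hc
  let φ : ℂ → ℂ := fun w => ζ + δ * (w - c)
  let ψ : ℂ → ℂ := fun z => (z - ζ) / δ + c
  have hφc : Continuous φ := by fun_prop
  have hψc : Continuous ψ := by fun_prop
  have hφψ : ∀ z, φ (ψ z) = z := by intro z; simp only [φ, ψ]; field_simp; ring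
  have hψφ : ∀ z, ψ (φ z) = z := by intro z; simp only [φ, ψ]; field_simp; ring
  have hdist : ∀ z w, dist (φ z) (φ w) = δ * dist z w := by
    intro z w
    simp only [φ, dist_eq_norm]
    rw [show ζ + δ * (z - c) - (ζ + δ * (w - c)) = δ * (z - w) by ring, norm_mul,
      Complex.norm_real, Real.norm_of_nonneg hδ.le]
  have hφcc : φ c = ζ := by simp [φ]
  have hball : ball c 4 ⊆ φ ⁻¹' V := by
    intro w hw
    apply hUV (hrU _)
    rw [mem_ball] at hw ⊢
    rw [← hφcc, hdist]
    nlinarith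
  have hVb : IsBounded (φ ⁻¹' V) := by
    rw [Metric.isBounded_iff]
    refine ⟨(M + M) / δ, fun x hx y hy => ?_⟩
    rw [le_div_iff₀ hδ, mul_comm, ← hdist]
    exact (dist_le_norm_add_norm _ _).trans (add_le_add (hM _ hx) (hM _ hy))
  obtain ⟨γ, h1, h2, h3, h4⟩ := Brick.core (φ ⁻¹' V) hVb hball
  have hnot : ζ ∈ ((φ ∘ γ) '' sphere (0 : ℂ) 1)ᶜ := by
    rintro ⟨t, ht, hζt⟩
    obtain ⟨-, w, hw, hd⟩ := h3 _ ⟨t, ht, rfl⟩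
    have : γ t = c := by rw [← hψφ (γ t), ← hψφ c, hφcc]; congr 1
    rw [this] at hd
    apply hw (hball _)
    rw [mem_ball, dist_comm]; linarith
  refine ⟨φ ∘ γ, hφc.comp_continuousOn h1, ?_, ?_, hnot, ?_⟩
  · intro x hx y hy h
    apply h2 hx hy
    rw [← hψφ (γ x), ← hψφ (γ y)]
    exact congrArg ψ h
  · rintro _ ⟨t, ht, rfl⟩
    obtain ⟨hV, w, hw, hd⟩ := h3 _ ⟨t, ht, rfl⟩
    refine ⟨hV, ?_⟩
    refine lt_of_le_of_lt (Brick.infDist_frontier_le (w := φ w) hV hw) ?_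
    rw [Function.comp_apply, hdist]
    nlinarith
  · set T := connectedComponentIn ((φ ∘ γ) '' sphere (0 : ℂ) 1)ᶜ ζ with hT
    have hTp : IsPreconnected T := isPreconnected_connectedComponentIn
    have hb := h4 (ψ '' T) (hTp.image _ hψc.continuousOn) ?_ ?_
    · obtain ⟨K, hK⟩ := Metric.isBounded_iff.1 hb
      rw [Metric.isBounded_iff]
      refine ⟨δ * K, fun x hx y hy => ?_⟩
      rw [← hφψ x, ← hφψ y, hdist]
      have := hK ⟨x, hx, rfl⟩ ⟨y, hy, rfl⟩
      gcongr
    · rintro _ ⟨z, hz, rfl⟩ ⟨t, ht, h⟩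
      apply connectedComponentIn_subset _ _ hz
      exact ⟨t, ht, by rw [Function.comp_apply, h, hφψ]⟩
    · refine ⟨ζ, mem_connectedComponentIn hnot, ?_⟩
      simp [ψ, hc]
end

section
/- Let F ⊆ ℂ be a closed set with the property that for every function f : ℂ → ℂ that is continuous on F, holomorphic on the interior of F, and has no zeros on F, there exists a function g : ℂ → ℂ, continuous on F and holomorphic on the interior of F, with exp(g(z)) = f(z) for all z ∈ F. Then every connected component of ℂ \ F is unbounded, i.e. F has no holes. -/
open Complex Metric Bornology

theorem exists_log_imp_no_holes (F : Set ℂ) (hF : IsClosed F)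
    (hlog : ∀ f : ℂ → ℂ, ContinuousOn f F → DifferentiableOn ℂ f (interior F) →
      (∀ z ∈ F, f z ≠ 0) →
      ∃ g : ℂ → ℂ, ContinuousOn g F ∧ DifferentiableOn ℂ g (interior F) ∧
        ∀ z ∈ F, Complex.exp (g z) = f z) :
    ∀ z ∈ Fᶜ, ¬ IsBounded (connectedComponentIn Fᶜ z) := by
  classical
  intro a ha hb
  obtain ⟨g, hg, -, hge⟩ := hlog (fun z => z - a) (by fun_prop) (by fun_prop)
    (fun z hz h => ha (by rwa [sub_eq_zero.mp h] at hz))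
  set U := connectedComponentIn Fᶜ a with hU
  have haU : a ∈ U := mem_connectedComponentIn ha
  have hUo : IsOpen U := hF.isOpen_compl.connectedComponentIn
  have hfr : ∀ x ∈ frontier U, x ∈ F := by
    intro x hx
    by_contra hxF
    have hxU : x ∈ U := by
      have hp : IsPreconnected (insert x U) :=
        isPreconnected_connectedComponentIn.subset_closure (Set.subset_insert _ _)
          (Set.insert_subset hx.1 subset_closure)
      exact hp.subset_connectedComponentIn (Set.mem_insert_of_mem _ haU)
        (Set.insert_subset hxF (connectedComponentIn_subset _ _)) (Set.mem_insert _ _)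
    rw [hUo.frontier_eq] at hx
    exact hx.2 hxU
  obtain ⟨G, hG⟩ := ContinuousMap.exists_restrict_eq hF
    (⟨F.domRestrict g, continuousOn_iff_continuous_domRestrict.mp hg⟩ : C(F, ℂ))
  have hGg : ∀ x ∈ F, G x = g x := fun x hx => by
    simpa using DFunLike.congr_fun hG ⟨x, hx⟩
  have hHc : Continuous (U.piecewise (fun z => exp (G z)) (fun z => z - a)) := by
    refine Continuous.piecewise (fun x hx => ?_) (by fun_prop) (by fun_prop)
    rw [hGg x (hfr x hx), hge x (hfr x hx)]
  have hHne : ∀ z, U.piecewise (fun z => exp (G z)) (fun z => z - a) z ≠ 0 := by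
    intro z
    by_cases hz : z ∈ U
    · simp [hz]
    · simp only [Set.piecewise_eq_of_notMem _ _ _ hz]
      exact fun h => hz (by rwa [sub_eq_zero.mp h])
  obtain ⟨h, ⟨-, hh⟩, -⟩ := isCoveringMap_exp.existsUnique_continuousMap_lifts
    (⟨fun z => ⟨_, hHne z⟩, hHc.subtype_mk _⟩ : C(ℂ, {z : ℂ // z ≠ 0})) 0
    (log (U.piecewise (fun z => exp (G z)) (fun z => z - a) 0))
    (Subtype.ext (exp_log (hHne 0)))
  have hh' : ∀ z, z ∉ U → exp (h z) = z - a := by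
    intro z hz
    have := congrArg Subtype.val (congrFun hh z)
    simpa [hz] using this
  obtain ⟨R, hR0, hR⟩ := hb.subset_ball_lt 0 a
  have hout : ∀ t : ℝ, exp (h (circleMap a R t)) = R * exp (t * I) := by
    intro t
    rw [hh']
    · simp [circleMap]
    · intro hm
      have := hR hm
      simp [circleMap, abs_of_pos hR0] at this
  have key := isCoveringMap_exp.const_of_comp (A := ℝ)
    (g := fun t : ℝ => h (circleMap a R t) - t * I) (by fun_prop)
    (fun s t => by
      apply Subtype.ext
      simp only [exp_sub, hout]
      rw [mul_div_cancel_right₀ _ (exp_ne_zero _), mul_div_cancel_right₀ _ (exp_ne_zero _)])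
    0 (2 * Real.pi)
  have hper : circleMap a R (2 * Real.pi) = circleMap a R 0 := by simp [circleMap]
  simp only [hper] at key
  have h2 : (2 * Real.pi * I : ℂ) = 0 := by
    push_cast at key
    linear_combination key
  simp [Real.pi_ne_zero] at h2
end

section
/- Let F ⊆ ℂ be a closed set, let n₀ be a natural number, let S = {z ∈ ℂ : |z| = n₀} be the circle of radius n₀, and let B be a bounded connected component of ℂ \ (F ∪ closedBall(0, n₀)). Then the set Γ = (∂B ∩ S) \ F is open in the subspace topology of S, where ∂B denotes the topological frontier of B. -/
open Complex Metric Bornology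

theorem boundary_trace_open (F : Set ℂ) (hF : IsClosed F) (n₀ : ℕ)
    (S : Set ℂ) (hS : S = sphere (0 : ℂ) (n₀ : ℝ))
    (B : Set ℂ)
    (hB : ∃ z ∈ (F ∪ closedBall (0 : ℂ) (n₀ : ℝ))ᶜ,
      B = connectedComponentIn (F ∪ closedBall (0 : ℂ) (n₀ : ℝ))ᶜ z)
    (hBb : IsBounded B) :
    IsOpen ((fun z : S => (z : ℂ)) ⁻¹' ((frontier B ∩ S) \ F)) := by
  obtain ⟨z₀, hz₀, hBeq⟩ := hB
  have hBsub : B ⊆ (F ∪ closedBall (0 : ℂ) (n₀ : ℝ))ᶜ := by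
    rw [hBeq]; exact connectedComponentIn_subset _ _
  rcases Nat.eq_zero_or_pos n₀ with h0 | hpos
  · have : Subsingleton S := by
      constructor
      rintro ⟨a, ha⟩ ⟨b, hb⟩
      subst h0
      simp only [hS, mem_sphere, Nat.cast_zero, dist_zero_right, norm_eq_zero] at ha hb
      simp [ha, hb]
    exact isOpen_discrete _
  have hr : (0 : ℝ) < n₀ := by exact_mod_cast hpos
  rw [isOpen_iff_mem_nhds]
  rintro ⟨w, hw⟩ ⟨⟨hwB, -⟩, hwF⟩
  change w ∈ frontier B at hwB
  change w ∉ F at hwF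
  have hwn : ‖w‖ = n₀ := by simpa [hS] using hw
  have hw0 : w ≠ 0 := by
    rw [← norm_pos_iff, hwn]; exact hr
  -- the polar map
  let f : ℝ × ℝ → ℂ := fun p => (p.1 : ℂ) * w * exp ((p.2 : ℂ) * I)
  have hf : Continuous f := by fun_prop
  have hfw : f (1, 0) = w := by simp [f]
  have hfn : ∀ p : ℝ × ℝ, 0 < p.1 → ‖f p‖ = p.1 * n₀ := by
    intro p hp
    simp only [f, norm_mul, norm_exp_ofReal_mul_I, hwn, mul_one, norm_real, Real.norm_eq_abs,
      abs_of_pos hp]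
  have hev : ∀ᶠ p in nhds ((1 : ℝ), (0 : ℝ)), f p ∈ Fᶜ := by
    apply hf.continuousAt.eventually_mem
    rw [hfw]
    exact hF.isOpen_compl.mem_nhds hwF
  obtain ⟨δ, hδ, hball⟩ := Metric.eventually_nhds_iff_ball.1 hev
  let A : Set ℂ := f '' (Set.Ioo (1 : ℝ) (1 + δ) ×ˢ Set.Ioo (-δ) δ)
  have hApre : IsPreconnected A :=
    (isPreconnected_Ioo.prod isPreconnected_Ioo).image _ hf.continuousOn
  have hAsub : A ⊆ (F ∪ closedBall (0 : ℂ) (n₀ : ℝ))ᶜ := by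
    rintro _ ⟨⟨t, θ⟩, ⟨ht, hθ⟩, rfl⟩
    simp only [Set.mem_Ioo] at ht hθ
    rintro (h | h)
    · refine hball (t, θ) ?_ h
      rw [mem_ball, Prod.dist_eq, max_lt_iff, Real.dist_eq, Real.dist_eq, abs_lt, abs_lt]
      constructor <;> constructor <;> simp <;> linarith
    · rw [mem_closedBall, dist_zero_right, hfn _ (by simp; linarith)] at h
      simp only at h
      nlinarith
  have hP : ∀ᶠ z in nhds w, z ∉ F ∧ (z ∈ (closedBall (0 : ℂ) (n₀ : ℝ))ᶜ → z ∈ A) := by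
    have h1 : ∀ᶠ z in nhds w, z ∈ Fᶜ := hF.isOpen_compl.mem_nhds hwF
    have h2 : ∀ᶠ z in nhds w, ‖z‖ / n₀ < 1 + δ := by
      have hc : Continuous fun z : ℂ => ‖z‖ / (n₀ : ℝ) := by fun_prop
      refine hc.continuousAt.eventually_lt continuousAt_const ?_
      rw [hwn, div_self hr.ne']; linarith
    have h3 : ∀ᶠ z in nhds w, arg (z / w) ∈ Set.Ioo (-δ) δ := by
      have hc : ContinuousAt (fun z : ℂ => arg (z / w)) w := by
        refine ContinuousAt.comp (g := arg) (f := fun z : ℂ => z / w) ?_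
          (by fun_prop)
        apply continuousAt_arg
        simp [div_self hw0]
      apply hc.eventually_mem
      rw [div_self hw0, arg_one]
      exact Ioo_mem_nhds (by linarith) hδ
    filter_upwards [h1, h2, h3] with z h1 h2 h3
    refine ⟨h1, fun hz => ⟨(‖z‖ / n₀, arg (z / w)), ⟨⟨?_, h2⟩, h3⟩, ?_⟩⟩
    · simp only [Set.mem_compl_iff, mem_closedBall, dist_zero_right, not_le] at hz
      simpa [lt_div_iff₀ hr] using hz
    · have h := norm_mul_exp_arg_mul_I (z / w)
      rw [norm_div, hwn] at h
      calc _ = (((‖z‖ / n₀ : ℝ) : ℂ) * exp (arg (z / w) * I)) * w := by simp only [f]; ring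
        _ = z := by rw [h, div_mul_cancel₀ _ hw0]
  have hAB : A ⊆ B := by
    have hcl : w ∈ closure B := frontier_subset_closure hwB
    obtain ⟨b, hbB, hb⟩ := ((mem_closure_iff_frequently.1 hcl).and_eventually hP).exists
    have hbA : b ∈ A := hb.2 fun h => hBsub hbB (Or.inr h)
    have hBc : B = connectedComponentIn (F ∪ closedBall (0 : ℂ) (n₀ : ℝ))ᶜ b := by
      rw [hBeq] at hbB ⊢
      exact connectedComponentIn_eq hbB
    rw [hBc]
    exact hApre.subset_connectedComponentIn hbA hAsub
  have hPP := (continuous_subtype_val (p := (· ∈ S))).continuousAt (x := ⟨w, hw⟩)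
    |>.eventually (eventually_eventually_nhds.2 hP)
  filter_upwards [hPP]
  rintro ⟨u, hu⟩ hPu
  change ∀ᶠ z in nhds u, _ at hPu
  have hun : ‖u‖ = n₀ := by simpa [hS] using hu
  refine ⟨⟨⟨?_, fun h => ?_⟩, hu⟩, hPu.self_of_nhds.1⟩
  · have hcl : u ∈ closure (closedBall (0 : ℂ) (n₀ : ℝ))ᶜ := by
      rw [closure_compl, interior_closedBall _ hr.ne']
      simp [hun]
    refine mem_closure_iff_frequently.2 ?_
    refine ((mem_closure_iff_frequently.1 hcl).and_eventually hPu).mono ?_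
    rintro z ⟨hz, hz'⟩
    exact hAB (hz'.2 hz)
  · exact hBsub (interior_subset h) (Or.inr (by simp [hun]))
end

section
/- Let F ⊆ ℂ be a closed set, let n₀ be a natural number, let S = {z ∈ ℂ : |z| = n₀}, and let B₁ and B₂ be two distinct bounded connected components of ℂ \ (F ∪ closedBall(0, n₀)). Then the sets Γ₁ = (∂B₁ ∩ S) \ F and Γ₂ = (∂B₂ ∩ S) \ F are disjoint, where ∂B denotes the topological frontier of B. -/
open Complex Metric Bornology

lemma aux_conn (n : ℕ) (p : ℂ) (hp : ‖p‖ = n) (ε : ℝ) (hε : 0 < ε) :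
    ∃ η > 0, ∀ z₁ ∈ ball p η, ∀ z₂ ∈ ball p η, (n : ℝ) < ‖z₁‖ → (n : ℝ) < ‖z₂‖ →
      ∃ C : Set ℂ, IsPreconnected C ∧ z₁ ∈ C ∧ z₂ ∈ C ∧
        ∀ w ∈ C, w ∈ ball p ε ∧ (n : ℝ) < ‖w‖ := by
  rcases Nat.eq_zero_or_pos n with h0 | hn
  · subst h0
    have hp0 : p = 0 := by simpa using hp
    subst hp0
    refine ⟨ε, hε, fun z₁ h₁ z₂ h₂ g₁ g₂ => ⟨ball 0 ε \ {0}, ?_, ?_, ?_, ?_⟩⟩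
    · have hI : ball (0 : ℂ) ε \ {0} = Complex.exp '' {z : ℂ | z.re < Real.log ε} := by
        ext w
        constructor
        · rintro ⟨hw, hw0⟩
          have hw0' : w ≠ 0 := hw0
          refine ⟨Complex.log w, ?_, Complex.exp_log hw0'⟩
          rw [Set.mem_setOf_eq, Complex.log_re]
          exact Real.log_lt_log (norm_pos_iff.2 hw0') (by simpa using hw)
        · rintro ⟨z, hz, rfl⟩
          refine ⟨?_, Complex.exp_ne_zero z⟩
          rw [mem_ball_zero_iff, Complex.norm_exp]
          exact (Real.lt_log_iff_exp_lt hε).1 hz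
      rw [hI]
      exact (convex_halfSpace_re_lt _).isPreconnected.image _ Complex.continuous_exp.continuousOn
    · exact ⟨h₁, by simpa using g₁⟩
    · exact ⟨h₂, by simpa using g₂⟩
    · rintro w ⟨hw, hw'⟩
      exact ⟨hw, by simpa using hw'⟩
  · have hn' : (0 : ℝ) < n := by exact_mod_cast hn
    obtain ⟨s, hs, hsε⟩ : ∃ s : ℝ, 0 < s ∧ s * n < ε :=
      ⟨ε / (2 * n), by positivity, by field_simp; linarith⟩
    set q : ℂ := p + s • p with hq
    have hpp : inner ℝ p p = (n : ℝ) ^ 2 := by rw [real_inner_self_eq_norm_sq, hp]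
    have hpq : (n : ℝ) ^ 2 < inner ℝ p q := by
      rw [hq, inner_add_right, inner_smul_right, hpp]
      have : 0 < s * (n : ℝ) ^ 2 := by positivity
      linarith
    have hqn : (n : ℝ) < ‖q‖ := by
      have h := real_inner_le_norm p q
      rw [hp] at h
      nlinarith
    have hqε : q ∈ ball p ε := by
      rw [mem_ball, dist_eq_norm, hq, add_sub_cancel_left, norm_smul, hp, Real.norm_of_nonneg hs.le]
      exact hsε
    have hc : Continuous fun z : ℂ => (inner ℝ z q : ℝ) := by fun_prop
    obtain ⟨η, hη, hηs⟩ := Metric.isOpen_iff.1 (isOpen_lt continuous_const hc) p hpq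
    have key : ∀ z ∈ ball p (min η ε), (n : ℝ) < ‖z‖ → ∀ w ∈ segment ℝ z q,
        w ∈ ball p ε ∧ (n : ℝ) < ‖w‖ := by
      intro z hz hzn w hw
      refine ⟨(convex_ball p ε).segment_subset (ball_subset_ball (min_le_right _ _) hz) hqε hw, ?_⟩
      have hzq : (n : ℝ) ^ 2 < inner ℝ z q := hηs (ball_subset_ball (min_le_left _ _) hz)
      obtain ⟨a, b, ha, hb, hab, rfl⟩ := hw
      have e : ‖a • z + b • q‖ ^ 2 = a ^ 2 * ‖z‖ ^ 2 + 2 * (a * b) * inner ℝ z q + b ^ 2 * ‖q‖ ^ 2 := by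
        rw [norm_add_sq_real, norm_smul, norm_smul, real_inner_smul_left, real_inner_smul_right,
          mul_pow, mul_pow, Real.norm_eq_abs, Real.norm_eq_abs, sq_abs, sq_abs]
        ring
      refine lt_of_pow_lt_pow_left₀ 2 (norm_nonneg _) ?_
      rw [e]
      have hz2 : (n : ℝ) ^ 2 < ‖z‖ ^ 2 := by gcongr
      have hq2 : (n : ℝ) ^ 2 < ‖q‖ ^ 2 := by gcongr
      have hab2 : (n : ℝ) ^ 2 = a ^ 2 * n ^ 2 + 2 * (a * b) * n ^ 2 + b ^ 2 * n ^ 2 := by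
        have : (n : ℝ) ^ 2 = (a + b) ^ 2 * n ^ 2 := by rw [hab]; ring
        linarith
      have t2 : 2 * (a * b) * (n : ℝ) ^ 2 ≤ 2 * (a * b) * inner ℝ z q := by gcongr
      have t3 : b ^ 2 * (n : ℝ) ^ 2 ≤ b ^ 2 * ‖q‖ ^ 2 := by gcongr
      rcases ha.eq_or_lt with h | h
      · subst h
        have : b = 1 := by linarith
        subst this
        linarith
      · have t1 : a ^ 2 * (n : ℝ) ^ 2 < a ^ 2 * ‖z‖ ^ 2 := by gcongr
        linarith
    refine ⟨min η ε, lt_min hη hε, fun z₁ h₁ z₂ h₂ g₁ g₂ =>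
      ⟨segment ℝ z₁ q ∪ segment ℝ z₂ q, ?_, ?_, ?_, ?_⟩⟩
    · exact IsPreconnected.union q (right_mem_segment ℝ _ _) (right_mem_segment ℝ _ _)
        (convex_segment _ _).isPreconnected (convex_segment _ _).isPreconnected
    · exact Or.inl (left_mem_segment ℝ _ _)
    · exact Or.inr (left_mem_segment ℝ _ _)
    · rintro w (hw | hw)
      · exact key z₁ h₁ g₁ w hw
      · exact key z₂ h₂ g₂ w hw

open Complex Metric Bornology

theorem boundary_traces_disjoint (F : Set ℂ) (hF : IsClosed F) (n₀ : ℕ)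
    (S : Set ℂ) (hS : S = sphere (0 : ℂ) (n₀ : ℝ))
    (B₁ B₂ : Set ℂ)
    (hB₁ : ∃ z ∈ (F ∪ closedBall (0 : ℂ) (n₀ : ℝ))ᶜ,
      B₁ = connectedComponentIn (F ∪ closedBall (0 : ℂ) (n₀ : ℝ))ᶜ z)
    (hB₂ : ∃ z ∈ (F ∪ closedBall (0 : ℂ) (n₀ : ℝ))ᶜ,
      B₂ = connectedComponentIn (F ∪ closedBall (0 : ℂ) (n₀ : ℝ))ᶜ z)
    (hB₁b : IsBounded B₁) (hB₂b : IsBounded B₂) (hne : B₁ ≠ B₂) :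
    Disjoint ((frontier B₁ ∩ S) \ F) ((frontier B₂ ∩ S) \ F) := by
  obtain ⟨a₁, ha₁, rfl⟩ := hB₁
  obtain ⟨a₂, ha₂, rfl⟩ := hB₂
  subst hS
  rw [Set.disjoint_left]
  rintro p ⟨⟨hp₁, hpS⟩, hpF⟩ ⟨⟨hp₂, -⟩, -⟩
  apply hne
  obtain ⟨ε, hε, hεF⟩ := Metric.isOpen_iff.1 hF.isOpen_compl p hpF
  obtain ⟨η, hη, H⟩ := aux_conn n₀ p (by simpa using hpS) ε hε
  obtain ⟨z₁, hz₁, d₁⟩ := Metric.mem_closure_iff.1 (frontier_subset_closure hp₁) η hη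
  obtain ⟨z₂, hz₂, d₂⟩ := Metric.mem_closure_iff.1 (frontier_subset_closure hp₂) η hη
  have out : ∀ z ∈ (F ∪ closedBall (0 : ℂ) (n₀ : ℝ))ᶜ, (n₀ : ℝ) < ‖z‖ := by
    intro z hz
    by_contra h
    exact hz (Or.inr (by simpa using h))
  obtain ⟨C, hC, c₁, c₂, hCs⟩ := H z₁ (by rwa [mem_ball']) z₂ (by rwa [mem_ball'])
    (out _ (connectedComponentIn_subset _ _ hz₁)) (out _ (connectedComponentIn_subset _ _ hz₂))
  have hsub : C ⊆ (F ∪ closedBall (0 : ℂ) (n₀ : ℝ))ᶜ := by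
    rintro w hw (h | h)
    · exact hεF (hCs w hw).1 h
    · have := (hCs w hw).2
      rw [mem_closedBall_zero_iff] at h
      linarith
  have h12 := hC.subset_connectedComponentIn c₁ hsub c₂
  rw [connectedComponentIn_eq hz₁, connectedComponentIn_eq hz₂, connectedComponentIn_eq h12]
end

section
/- Let U ⊆ ℂ be a bounded domain and let B_u be the unbounded connected component of ℂ \ U. Then the set V = ℂ \ B_u equals the union of U with all bounded connected components of ℂ \ U, and V is open and connected. -/
open Complex Metric Bornology

theorem outer_preconnected (R : ℝ) (hR : 0 < R) : IsPreconnected (closedBall (0 : ℂ) R)ᶜ := by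
  have h : (closedBall (0 : ℂ) R)ᶜ = Complex.exp '' {z : ℂ | Real.log R < z.re} := by
    ext w
    simp only [Set.mem_compl_iff, mem_closedBall, dist_zero_right, not_le, Set.mem_image,
      Set.mem_setOf_eq]
    constructor
    · intro hw
      have hw0 : w ≠ 0 := by
        rintro rfl
        simp at hw
        linarith
      refine ⟨Complex.log w, ?_, Complex.exp_log hw0⟩
      rw [Complex.log_re]
      exact Real.log_lt_log hR hw
    · rintro ⟨z, hz, rfl⟩
      rw [Complex.norm_exp]
      exact (Real.log_lt_iff_lt_exp hR).1 hz
  rw [h]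
  exact (convex_halfSpace_re_gt _).isPreconnected.image _ Complex.continuous_exp.continuousOn

theorem component_closed (F : Set ℂ) (hF : IsClosed F) (z : ℂ) (hz : z ∈ F) :
    IsClosed (connectedComponentIn F z) := by
  apply isClosed_of_closure_subset
  exact isPreconnected_connectedComponentIn.closure.subset_connectedComponentIn
    (subset_closure (mem_connectedComponentIn hz))
    (closure_minimal (connectedComponentIn_subset F z) hF)

/-- One half of the separation argument: the part `B` away from `U` is empty. -/
theorem separated_part_empty (U : Set ℂ) (hUn : U.Nonempty) (z : ℂ) (hz : z ∈ Uᶜ) (A B : Set ℂ)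
    (hA : IsOpen A) (hB : IsOpen B) (hAB : Disjoint A B)
    (hcov : A ∪ B = (connectedComponentIn Uᶜ z)ᶜ) (hUA : U ⊆ A) : B = ∅ := by
  set C := connectedComponentIn Uᶜ z with hC
  have hCp : IsPreconnected C := isPreconnected_connectedComponentIn
  have hzC : z ∈ C := mem_connectedComponentIn hz
  have hmem : ∀ x, x ∈ Aᶜ ↔ x ∈ C ∨ x ∈ B := by
    intro x
    have h1 := Set.ext_iff.1 hcov x
    have h2 : x ∈ A → x ∉ B := fun h h' => Set.disjoint_left.1 hAB h h'
    simp only [Set.mem_union, Set.mem_compl_iff] at h1 ⊢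
    tauto
  have key : ∀ u v : Set ℂ, IsClosed u → IsClosed v → Aᶜ ⊆ u ∪ v → Disjoint u v → C ⊆ u →
      Aᶜ ⊆ u := by
    intro u v hu hv huv hd hCu
    have hQ : v ∩ Aᶜ = B ∩ uᶜ := by
      ext x
      have h1 := hmem x
      have h2 : x ∈ u → x ∉ v := fun h h' => Set.disjoint_left.1 hd h h'
      have h3 := @huv x
      have h4 := @hCu x
      simp only [Set.mem_inter_iff, Set.mem_union] at *
      simp only [Set.mem_compl_iff] at *
      tauto
    have hclop : IsClopen (v ∩ Aᶜ) :=
      ⟨hv.inter hA.isClosed_compl, by rw [hQ]; exact hB.inter hu.isOpen_compl⟩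
    rcases isClopen_iff.1 hclop with h | h
    · intro x hx
      rcases huv hx with h' | h'
      · exact h'
      · exact absurd (h ▸ (⟨h', hx⟩ : x ∈ v ∩ Aᶜ)) (Set.notMem_empty x)
    · obtain ⟨p, hp⟩ := hUn
      exact absurd (hUA hp) (h.symm ▸ Set.mem_univ p : p ∈ v ∩ Aᶜ).2
  have hconn : IsPreconnected Aᶜ := by
    rw [isPreconnected_iff_subset_of_fully_disjoint_closed hA.isClosed_compl]
    intro u v hu hv huv hd
    have hCA : C ⊆ Aᶜ := fun x hx => (hmem x).2 (Or.inl hx)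
    rcases isPreconnected_iff_subset_of_disjoint_closed.1 hCp u v hu hv (hCA.trans huv)
      (by rw [hd.inter_eq, Set.inter_empty]) with h | h
    · exact Or.inl (key u v hu hv huv hd h)
    · exact Or.inr (key v u hv hu (by rwa [Set.union_comm]) hd.symm h)
  have hsub : Aᶜ ⊆ C := hconn.subset_connectedComponentIn ((hmem z).2 (Or.inl hzC))
    (Set.compl_subset_compl.2 hUA)
  rw [Set.eq_empty_iff_forall_notMem]
  intro x hx
  have h1 : x ∈ Cᶜ := hcov ▸ Or.inr hx
  exact h1 (hsub ((hmem x).2 (Or.inr hx)))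

theorem filling_eq_compl_unbounded_component (U : Set ℂ) (hUo : IsOpen U)
    (hUc : IsConnected U) (hUb : IsBounded U) (Bu : Set ℂ)
    (hBu : ∃ z ∈ Uᶜ, Bu = connectedComponentIn Uᶜ z)
    (hBub : ¬ IsBounded Bu) :
    Buᶜ = U ∪ {z : ℂ | z ∈ Uᶜ ∧ IsBounded (connectedComponentIn Uᶜ z)} ∧
      IsOpen Buᶜ ∧ IsConnected Buᶜ := by
  obtain ⟨z, hz, rfl⟩ := hBu
  have hUsub : U ⊆ (connectedComponentIn Uᶜ z)ᶜ :=
    fun x hx hx' => connectedComponentIn_subset _ _ hx' hx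
  have hopen : IsOpen (connectedComponentIn Uᶜ z)ᶜ :=
    (component_closed _ hUo.isClosed_compl z hz).isOpen_compl
  refine ⟨?_, hopen, hUc.nonempty.mono hUsub, ?_⟩
  · obtain ⟨R, hR, hUR⟩ := hUb.subset_closedBall_lt 0 0
    have hout : ∀ w, ¬ IsBounded (connectedComponentIn Uᶜ w) →
        (closedBall (0 : ℂ) R)ᶜ ⊆ connectedComponentIn Uᶜ w := by
      intro w hw
      have : ¬ connectedComponentIn Uᶜ w ⊆ closedBall 0 R :=
        fun h => hw (isBounded_closedBall.subset h)
      obtain ⟨x, hx, hxR⟩ := Set.not_subset.1 this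
      rw [connectedComponentIn_eq hx]
      exact (outer_preconnected R hR).subset_connectedComponentIn hxR
        (Set.compl_subset_compl.2 hUR)
    ext w
    simp only [Set.mem_compl_iff, Set.mem_union, Set.mem_setOf_eq]
    constructor
    · intro hw
      by_cases hwU : w ∈ U
      · exact Or.inl hwU
      · refine Or.inr ⟨hwU, ?_⟩
        by_contra hb
        have hne : ¬ connectedComponentIn Uᶜ z ⊆ closedBall 0 R :=
          fun h => hBub (isBounded_closedBall.subset h)
        obtain ⟨x, hx, hxR⟩ := Set.not_subset.1 hne
        have h2 := hout w hb hxR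
        apply hw
        rw [connectedComponentIn_eq hx, ← connectedComponentIn_eq h2]
        exact mem_connectedComponentIn hwU
    · rintro (hw | ⟨_, hb⟩) hw'
      · exact hUsub hw hw'
      · rw [connectedComponentIn_eq hw'] at hBub
        exact hBub hb
  · rw [isPreconnected_iff_subset_of_disjoint]
    intro u v hu hv huv hd
    set D := (connectedComponentIn Uᶜ z)ᶜ with hD
    have hdis : Disjoint (D ∩ u) (D ∩ v) := by
      rw [Set.disjoint_left]
      rintro x ⟨h1, h2⟩ ⟨_, h3⟩
      have : x ∈ D ∩ (u ∩ v) := ⟨h1, h2, h3⟩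
      rw [hd] at this
      exact this
    have hcov : (D ∩ u) ∪ (D ∩ v) = D := by
      rw [← Set.inter_union_distrib_left]
      exact Set.inter_eq_left.2 huv
    have hUd : U ∩ (u ∩ v) = ∅ :=
      Set.subset_empty_iff.1 (hd ▸ Set.inter_subset_inter_left _ hUsub)
    rcases isPreconnected_iff_subset_of_disjoint.1 hUc.isPreconnected u v hu hv
      (hUsub.trans huv) hUd with h | h
    · left
      have := separated_part_empty U hUc.nonempty z hz _ _ (hopen.inter hu) (hopen.inter hv)
        hdis hcov (Set.subset_inter hUsub h)
      rw [this, Set.union_empty] at hcov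
      exact Set.inter_eq_left.1 hcov
    · right
      have := separated_part_empty U hUc.nonempty z hz _ _ (hopen.inter hv) (hopen.inter hu)
        hdis.symm (by rw [Set.union_comm]; exact hcov) (Set.subset_inter hUsub h)
      rw [this, Set.empty_union] at hcov
      exact Set.inter_eq_left.1 hcov
end

section
/- Let F ⊆ ℂ be a closed Arakelian set, and let f : ℂ → ℂ be continuous on F, holomorphic on the interior of F, with no zeros on F. Then there exists an open set V with F ⊆ V, each connected component of V simply connected, and a continuous extension f̃ of f|F to ℂ such that f̃ has no zeros on V; moreover, there exists a continuous function g̃ : V → ℂ with exp(g̃(z)) = f̃(z) for all z ∈ V. -/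
open Complex Metric Bornology

/-- A closed set `F ⊆ ℂ` is Arakelian if every connected component of its complement
is unbounded, and for every compact `K`, the union of all bounded connected components
of `ℂ \ (F ∪ K)` is bounded. -/
def IsArakelian (F : Set ℂ) : Prop :=
  (∀ z ∈ Fᶜ, ¬ IsBounded (connectedComponentIn Fᶜ z)) ∧
  (∀ K : Set ℂ, IsCompact K →
    IsBounded {z : ℂ | z ∈ (F ∪ K)ᶜ ∧ IsBounded (connectedComponentIn (F ∪ K)ᶜ z)})


namespace ArkProof

/-- ordered product of edge labels along a walk -/
def pp {V M : Type*} [Mul M] (E : V → V → M) : V → List V → V → M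
  | a, [], b => E a b
  | a, c :: t, b => E a c * pp E c t b

/-- sum of edge labels along a walk -/
def ps {V M : Type*} [Add M] (E : V → V → M) : V → List V → V → M
  | a, [], b => E a b
  | a, c :: t, b => E a c + ps E c t b

/-- all the edges of a walk satisfy a relation -/
def al {V : Type*} (R : V → V → Prop) : V → List V → V → Prop
  | a, [], b => R a b
  | a, c :: t, b => R a c ∧ al R c t b

lemma pp_append {V M : Type*} [Semigroup M] (E : V → V → M) (a : V) (s : List V) (c : V)
    (t : List V) (b : V) : pp E a (s ++ c :: t) b = pp E a s c * pp E c t b := by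
  induction s generalizing a with
  | nil => rfl
  | cons x s ih => simp [pp, ih, mul_assoc]

lemma ps_append {V M : Type*} [AddSemigroup M] (E : V → V → M) (a : V) (s : List V) (c : V)
    (t : List V) (b : V) : ps E a (s ++ c :: t) b = ps E a s c + ps E c t b := by
  induction s generalizing a with
  | nil => rfl
  | cons x s ih => simp [ps, ih, add_assoc]

lemma al_append {V : Type*} (R : V → V → Prop) (a : V) (s : List V) (c : V)
    (t : List V) (b : V) : al R a (s ++ c :: t) b ↔ al R a s c ∧ al R c t b := by
  induction s generalizing a with
  | nil => rfl
  | cons x s ih => simp [al, ih, and_assoc]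

lemma al_mono {V : Type*} {R S : V → V → Prop} {a : V} {t : List V} {b : V}
    (h : al R a t b) (hRS : ∀ p q, R p q → S p q) : al S a t b := by
  induction t generalizing a with
  | nil => exact hRS _ _ h
  | cons x s ih => exact ⟨hRS _ _ h.1, ih h.2⟩

/-- if the labels vanish on all edges then the sum vanishes -/
lemma ps_zero {V M : Type*} [AddMonoid M] {w : V → V → M} {a : V} {t : List V} {b : V}
    (h : al (fun p q => w p q = 0) a t b) : ps w a t b = 0 := by
  induction t generalizing a with
  | nil => exact h
  | cons x s ih => simp [ps, ih h.2]; exact h.1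

lemma ps_add {V M : Type*} [AddCommMonoid M] (w w' : V → V → M) (a : V) (t : List V) (b : V) :
    ps (fun p q => w p q + w' p q) a t b = ps w a t b + ps w' a t b := by
  induction t generalizing a with
  | nil => rfl
  | cons x s ih => simp only [ps, ih]; abel

lemma ps_cobound {V : Type*} (f : V → ZMod 2) (a : V) (t : List V) (b : V) :
    ps (fun p q => f p + f q) a t b = f a + f b := by
  induction t generalizing a with
  | nil => rfl
  | cons x s ih => 
    simp only [ps, ih]
    have : f x + f x = 0 := CharTwo.add_self_eq_zero _
    linear_combination this

lemma al_of_mem {V : Type*} {R : V → V → Prop} {a : V} {t : List V} {b : V}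
    (S : Set V) (ha : a ∈ S) (ht : ∀ p ∈ t, p ∈ S) (hb : b ∈ S)
    (h : ∀ p ∈ S, ∀ q ∈ S, R p q) : al R a t b := by
  induction t generalizing a with
  | nil => exact h _ ha _ hb
  | cons x s ih => exact ⟨h _ ha _ (ht x (by simp)), ih (ht x (by simp)) 
      (fun p hp => ht p (by simp [hp]))⟩

lemma al_and {V : Type*} {R S : V → V → Prop} {a : V} {t : List V} {b : V}
    (h : al R a t b) (h' : al S a t b) : al (fun p q => R p q ∧ S p q) a t b := by
  induction t generalizing a with
  | nil => exact ⟨h, h'⟩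
  | cons x s ih => exact ⟨⟨h.1, h'.1⟩, ih h.2 h'.2⟩

/-- adjacency (or equality) in the grid -/
def Adj (a b : ℤ × ℤ) : Prop :=
  b = a ∨ (b.1 = a.1 + 1 ∧ b.2 = a.2) ∨ (b.1 = a.1 - 1 ∧ b.2 = a.2) ∨
   (b.1 = a.1 ∧ b.2 = a.2 + 1) ∨ (b.1 = a.1 ∧ b.2 = a.2 - 1)

/-- the crossing weight of the ray going up from the cell `(i,j)` -/
def wt (i j : ℤ) (a b : ℤ × ℤ) : ZMod 2 :=
  if a.2 = b.2 ∧ j < a.2 ∧ ((a.1 = i ∧ b.1 = i + 1) ∨ (a.1 = i + 1 ∧ b.1 = i)) then 1 else 0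

set_option maxHeartbeats 1000000 in
theorem discrete {G : Type*} [Group G] (E : ℤ × ℤ → ℤ × ℤ → G) (R : ℤ × ℤ → ℤ × ℤ → Prop)
    (Good : ℤ → ℤ → Prop) (hadj : ∀ a b, R a b → Adj a b)
    (E_self : ∀ a, R a a → E a a = 1)
    (E_inv : ∀ a b, R a b → E a b * E b a = 1)
    (hcell : ∀ i j, Good i j → R (i, j+1) (i, j) ∧ R (i, j) (i, j+1) ∧
      R (i, j) (i+1, j) ∧ R (i+1, j) (i, j) ∧
      E (i, j+1) (i+1, j+1) * E (i+1, j+1) (i+1, j) = E (i, j+1) (i, j) * E (i, j) (i+1, j) ∧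
      E (i+1, j) (i+1, j+1) * E (i+1, j+1) (i, j+1) = E (i+1, j) (i, j) * E (i, j) (i, j+1))
    (hodd : ∀ a t, al R a t a → ∀ i j, ps (wt i j) a t a ≠ 0 → Good i j) :
    ∀ a t, al R a t a → pp E a t a = 1 := by
  have key : ∀ m : ℤ, ∀ n s : ℕ, ∀ a t, t.length = n → (∀ p ∈ a :: t, m ≤ p.1 ∧ m ≤ p.2) →
      ((a :: t).map (fun p : ℤ × ℤ => (p.1 + p.2 - 2 * m).toNat)).sum = s →
      al R a t a → pp E a t a = 1 := by
    intro m n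
    induction n using Nat.strong_induction_on with
    | _ n ihn =>
    intro s
    induction s using Nat.strong_induction_on with
    | _ s ihs =>
    -- first the case where the start is maximal
    have main : ∀ v t, t.length = n → (∀ p ∈ v :: t, m ≤ p.1 ∧ m ≤ p.2) →
      ((v :: t).map (fun p : ℤ × ℤ => (p.1 + p.2 - 2 * m).toNat)).sum = s →
      (∀ p ∈ t, p.1 + p.2 ≤ v.1 + v.2) → al R v t v → pp E v t v = 1 := by
      intro v t hn hm hs hmax hal
      by_cases hv : v ∈ t
      · obtain ⟨t1, t2, rfl⟩ := List.append_of_mem hv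
        rw [al_append] at hal
        rw [pp_append, ihn t1.length (by simp at hn; omega) _ v t1 rfl
          (fun p hp => hm p (by simp at hp ⊢; tauto)) rfl hal.1, 
          ihn t2.length (by simp at hn; omega) _ v t2 rfl
          (fun p hp => hm p (by simp at hp ⊢; tauto)) rfl hal.2, one_mul]
      cases t with
      | nil => exact E_self _ hal
      | cons b t =>
      rcases List.eq_nil_or_concat t with rfl | ⟨mid, c, rfl⟩
      · exact E_inv _ _ hal.1
      · rw [List.concat_eq_append] at *
        have hal1 : R v b := hal.1
        have hal2 := hal.2
        rw [al_append] at hal2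
        obtain ⟨hal2, hal3⟩ := hal2
        change R c v at hal3
        have hpp : pp E v (b :: (mid ++ [c])) v = E v b * (pp E b mid c * E c v) := by
          change E v b * pp E b (mid ++ [c]) v = _
          rw [pp_append]; rfl
        rw [hpp]
        by_cases hbc : b = c
        · subst hbc
          rw [ihn mid.length (by simp at hn; omega) _ b mid rfl
            (fun p hp => hm p (by simp at hp ⊢; tauto)) rfl hal2, one_mul]
          exact E_inv _ _ hal1
        · have hbv : b ≠ v := by rintro rfl; simp at hv
          have hcv : c ≠ v := by rintro rfl; simp at hv
          have hb := hmax b (by simp)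
          have hc := hmax c (by simp)
          have a1 := hadj _ _ hal1
          have a2 := hadj _ _ hal3
          obtain ⟨i, j, rfl⟩ : ∃ i j : ℤ, v = (i+1, j+1) := ⟨v.1 - 1, v.2 - 1, by ext <;> simp⟩
          have hmid0 : ps (wt i j) b mid c = 0 := by
            apply ps_zero
            apply al_of_mem {p : ℤ × ℤ | p ≠ (i+1, j+1) ∧ p.1 + p.2 ≤ i + 1 + (j + 1)} ⟨hbv, hb⟩ 
              (fun p hp => ⟨?_, hmax p (by simp [hp])⟩) ⟨hcv, hc⟩
            · rintro ⟨p1, p2⟩ ⟨hp, hp'⟩ ⟨q1, q2⟩ ⟨hq, hq'⟩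
              simp only [ne_eq, Prod.mk.injEq] at hp hp' hq hq'
              unfold wt
              rw [if_neg]
              simp only
              omega
            · rintro rfl; simp [hp] at hv
          have hps : ps (wt i j) (i+1, j+1) (b :: (mid ++ [c])) (i+1, j+1) = 
              wt i j (i+1, j+1) b + wt i j c (i+1, j+1) := by
            change wt i j (i+1, j+1) b + ps (wt i j) b (mid ++ [c]) (i+1, j+1) = _
            rw [ps_append, hmid0, zero_add]; rfl
          have hG : ∀ x : ZMod 2, x = 1 → ps (wt i j) (i+1, j+1) (b :: (mid ++ [c])) (i+1, j+1) = x →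
              Good i j := by
            rintro x rfl hx
            exact hodd _ _ hal i j (by rw [hx]; decide)
          have fin : ∀ d : ℤ × ℤ, d = (i, j) → m ≤ i → m ≤ j → R d b → R c d → 
              E c (i+1, j+1) * E (i+1, j+1) b = E c d * E d b →
              E (i+1, j+1) b * (pp E b mid c * E c (i+1, j+1)) = 1 := by
            rintro d rfl hmi hmj h1 h2 h3
            have h4 : pp E (i, j) (b :: (mid ++ [c])) (i, j) = E (i, j) b * (pp E b mid c * E c (i, j)) := by
              change E (i, j) b * pp E b (mid ++ [c]) (i, j) = _
              rw [pp_append]; rfl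
            have h5 := ihs _ ?_ (i, j) (b :: (mid ++ [c])) hn ?_ rfl ?_
            · rw [h4] at h5
              have h6 : pp E b mid c * (E c (i, j) * E (i, j) b) = 1 := by
                rw [← mul_assoc]
                exact mul_eq_one_comm.mp h5
              rw [← h3] at h6
              rw [mul_eq_one_comm, mul_assoc]
              exact h6
            · rw [← hs]
              simp only [List.map_cons, List.sum_cons]
              omega
            · intro p hp
              rcases List.mem_cons.mp hp with rfl | hp
              · exact ⟨hmi, hmj⟩
              · exact hm p (by simp at hp ⊢; tauto)
            · exact ⟨h1, (al_append _ _ _ _ _ _).2 ⟨hal2, h2⟩⟩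
          have hmb := hm b (by simp)
          have hmc := hm c (by simp)
          obtain ⟨b1, b2⟩ := b
          obtain ⟨c1, c2⟩ := c
          simp only [Adj, ne_eq, Prod.mk.injEq] at a1 a2 hbv hcv hb hc hbc hmb hmc
          have hcase : (b1 = i ∧ b2 = j + 1 ∧ c1 = i + 1 ∧ c2 = j) ∨ 
             (c1 = i ∧ c2 = j + 1 ∧ b1 = i + 1 ∧ b2 = j) := by omega
          rcases hcase with ⟨rfl, rfl, rfl, rfl⟩ | ⟨rfl, rfl, rfl, rfl⟩
          · obtain ⟨g1, g2, g3, g4, g5, g6⟩ := hcell _ _ (hG _ (by simp [wt]) hps)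
            exact fin _ rfl (by omega) (by omega) g2 g4 g6
          · obtain ⟨g1, g2, g3, g4, g5, g6⟩ := hcell _ _ (hG _ (by simp [wt]) hps)
            exact fin _ rfl (by omega) (by omega) g3 g1 g5
    intro a t hn hm hs hal
    obtain ⟨v, hv, hvmax⟩ := Finset.exists_max_image (a :: t).toFinset (fun p : ℤ × ℤ => p.1 + p.2)
      ⟨a, by simp⟩
    simp only [List.mem_toFinset] at hv hvmax
    rcases List.mem_cons.mp hv with rfl | hv
    · exact main v t hn hm hs (fun p hp => hvmax p (by simp [hp])) hal
    · obtain ⟨t1, t2, rfl⟩ := List.append_of_mem hv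
      rw [pp_append, mul_eq_one_comm, ← pp_append]
      rw [al_append, and_comm, ← al_append] at hal
      refine main v (t2 ++ a :: t1) ?_ ?_ ?_ ?_ hal
      · simp at hn ⊢; omega
      · intro p hp; exact hm p (by simp at hp ⊢; tauto)
      · simp at hs ⊢; omega
      · intro p hp; exact hvmax p (by simp at hp ⊢; tauto)
  intro a t h
  obtain ⟨m, hm⟩ : ∃ m : ℤ, ∀ p ∈ a :: t, m ≤ p.1 ∧ m ≤ p.2 := by
    generalize a :: t = l
    induction l with
    | nil => exact ⟨0, by simp⟩
    | cons x l ih =>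
      obtain ⟨m, hm⟩ := ih
      refine ⟨min m (min x.1 x.2), ?_⟩
      intro p hp
      rcases List.mem_cons.mp hp with rfl | hp
      · omega
      · have := hm p hp
        omega
  exact key m _ _ a t rfl hm rfl h
end ArkProof

namespace ArkProof

lemma ps_congr {V M : Type*} [Add M] {w w' : V → V → M} {a : V} {t : List V} {b : V}
    (h : al (fun p q => w p q = w' p q) a t b) : ps w a t b = ps w' a t b := by
  induction t generalizing a with
  | nil => exact h
  | cons x s ih => simp only [ps, ih h.2]; rw [h.1]

lemma parity_horiz {R : ℤ × ℤ → ℤ × ℤ → Prop}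
    (a : ℤ × ℤ) (t : List (ℤ × ℤ)) (hal : al R a t a) (i j : ℤ)
    (h1 : ¬ R (i, j) (i+1, j)) (h2 : ¬ R (i+1, j) (i, j)) :
    ps (wt i j) a t a = ps (wt i (j-1)) a t a := by
  apply ps_congr
  refine al_mono hal ?_
  rintro ⟨p1, p2⟩ ⟨q1, q2⟩ h
  unfold wt
  simp only
  congr 1
  have h3 : ¬ (p1 = i ∧ p2 = j ∧ q1 = i + 1 ∧ q2 = j) := by
    rintro ⟨rfl, rfl, rfl, rfl⟩; exact h1 h
  have h4 : ¬ (q1 = i ∧ q2 = j ∧ p1 = i + 1 ∧ p2 = j) := by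
    rintro ⟨rfl, rfl, rfl, rfl⟩; exact h2 h
  apply propext
  omega

lemma parity_vert {R : ℤ × ℤ → ℤ × ℤ → Prop} (hadj : ∀ a b, R a b → Adj a b)
    (a : ℤ × ℤ) (t : List (ℤ × ℤ)) (hal : al R a t a) (i j : ℤ)
    (h1 : ¬ R (i, j) (i, j+1)) (h2 : ¬ R (i, j+1) (i, j)) :
    ps (wt i j) a t a = ps (wt (i-1) j) a t a := by
  let f : ℤ × ℤ → ZMod 2 := fun p => if p.1 = i ∧ j < p.2 then 1 else 0
  have : ps (wt i j) a t a = ps (fun p q => wt (i-1) j p q + (f p + f q)) a t a := by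
    apply ps_congr
    refine al_mono hal ?_
    rintro ⟨p1, p2⟩ ⟨q1, q2⟩ h
    have h0 := hadj _ _ h
    simp only [Adj, Prod.mk.injEq] at h0
    have h3 : ¬ (p1 = i ∧ p2 = j ∧ q1 = i ∧ q2 = j + 1) := by
      rintro ⟨rfl, rfl, rfl, rfl⟩; exact h1 h
    have h4 : ¬ (q1 = i ∧ q2 = j ∧ p1 = i ∧ p2 = j + 1) := by
      rintro ⟨rfl, rfl, rfl, rfl⟩; exact h2 h
    simp only [wt, f]
    have h11 : (1 : ZMod 2) + 1 = 0 := by decide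
    split_ifs <;> first | omega | simp [h11]
  rw [this, ps_add, ps_cobound, CharTwo.add_self_eq_zero, add_zero]

lemma parity_bdd {R : ℤ × ℤ → ℤ × ℤ → Prop} (hadj : ∀ a b, R a b → Adj a b)
    (a : ℤ × ℤ) (t : List (ℤ × ℤ)) (hal : al R a t a) :
    ∃ M : ℤ, ∀ i j, ps (wt i j) a t a ≠ 0 → |i| ≤ M ∧ |j| ≤ M := by
  obtain ⟨M, hM⟩ : ∃ M : ℤ, ∀ p ∈ a :: t, |p.1| ≤ M ∧ |p.2| ≤ M := by
    generalize a :: t = l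
    induction l with
    | nil => exact ⟨0, by simp⟩
    | cons x l ih =>
      obtain ⟨m, hm⟩ := ih
      refine ⟨max m (max |x.1| |x.2|), ?_⟩
      intro p hp
      rcases List.mem_cons.mp hp with rfl | hp
      · simp
      · have := hm p hp
        exact ⟨this.1.trans (by simp), this.2.trans (by simp)⟩
  have hS : al (fun p q => (|p.1| ≤ M ∧ |p.2| ≤ M) ∧ (|q.1| ≤ M ∧ |q.2| ≤ M)) a t a :=
    al_of_mem {p | |p.1| ≤ M ∧ |p.2| ≤ M} (hM _ (by simp)) (fun p hp => hM p (by simp [hp]))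
      (hM _ (by simp)) (fun p hp q hq => ⟨hp, hq⟩)
  have hal' := al_and hal hS
  refine ⟨M + 1, fun i j => ?_⟩
  contrapose!
  intro hij
  by_cases hj : j < -M
  · let f : ℤ × ℤ → ZMod 2 := fun p => if p.1 ≤ i then 1 else 0
    have : ps (wt i j) a t a = ps (fun p q => (f p + f q)) a t a := by
      apply ps_congr
      refine al_mono hal' ?_
      rintro ⟨p1, p2⟩ ⟨q1, q2⟩ ⟨h, h'⟩
      have h0 := hadj _ _ h
      simp only [Adj, Prod.mk.injEq, abs_le] at h0 h'
      simp only [wt, f]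
      have h11 : (1 : ZMod 2) + 1 = 0 := by decide
      split_ifs <;> first | omega | simp [h11]
    rw [this, ps_cobound, CharTwo.add_self_eq_zero]
  · apply ps_zero
    refine al_mono hal' ?_
    rintro ⟨p1, p2⟩ ⟨q1, q2⟩ ⟨h, h'⟩
    simp only [wt]
    rw [if_neg]
    simp only [abs_le] at h' hij
    rw [lt_abs] at hij
    omega

/-- A closed set without bounded relatively clopen parts. -/
def NoIsland (C : Set ℂ) : Prop :=
  ∀ A ⊆ C, IsBounded A → (∀ q ∈ C, ∀ᶠ q' in nhds q, q' ∈ C → (q' ∈ A ↔ q ∈ A)) → A = ∅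

/-- grid point -/
def pt (h : ℝ) (a : ℤ × ℤ) : ℂ := ⟨h * a.1, h * a.2⟩

/-- closed grid cell -/
def cell (h : ℝ) (i j : ℤ) : Set ℂ :=
  {q | h * i ≤ q.re ∧ q.re ≤ h * (i + 1) ∧ h * j ≤ q.im ∧ q.im ≤ h * (j + 1)}

/-- allowed edges -/
def Rel (h : ℝ) (W : Set ℂ) (a b : ℤ × ℤ) : Prop := Adj a b ∧ segment ℝ (pt h a) (pt h b) ⊆ W

lemma mem_horiz {h : ℝ} (hh : 0 < h) {q : ℂ} {i j : ℤ} (h1 : h * i ≤ q.re) (h2 : q.re ≤ h * (i+1))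
    (h3 : q.im = h * j) : q ∈ segment ℝ (pt h (i, j)) (pt h (i+1, j)) := by
  refine ⟨i + 1 - q.re / h, q.re / h - i, ?_, ?_, by ring, ?_⟩
  · rw [sub_nonneg, div_le_iff₀ hh]; linarith
  · rw [sub_nonneg, le_div_iff₀ hh]; linarith
  · apply Complex.ext
    · simp [pt]; field_simp; ring
    · simp [pt, h3]; field_simp; ring

lemma mem_vert {h : ℝ} (hh : 0 < h) {q : ℂ} {i j : ℤ} (h1 : h * j ≤ q.im) (h2 : q.im ≤ h * (j+1))
    (h3 : q.re = h * i) : q ∈ segment ℝ (pt h (i, j)) (pt h (i, j+1)) := by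
  refine ⟨j + 1 - q.im / h, q.im / h - j, ?_, ?_, by ring, ?_⟩
  · rw [sub_nonneg, div_le_iff₀ hh]; linarith
  · rw [sub_nonneg, le_div_iff₀ hh]; linarith
  · apply Complex.ext
    · simp [pt, h3]; field_simp; ring
    · simp [pt]; field_simp; ring

lemma parity_same {h : ℝ} (hh : 0 < h) {W : Set ℂ} (a : ℤ × ℤ) (t : List (ℤ × ℤ))
    (hal : al (Rel h W) a t a) {q : ℂ} (hq : q ∉ W) {i j i' j' : ℤ} 
    (h1 : q ∈ cell h i j) (h2 : q ∈ cell h i' j') :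
    ps (wt i j) a t a = ps (wt i' j') a t a := by
  have hor : ∀ i j : ℤ, h * i ≤ q.re → q.re ≤ h * (i+1) → q.im = h * j → 
      ps (wt i j) a t a = ps (wt i (j-1)) a t a := by
    intro i j h1 h2 h3
    have := mem_horiz hh h1 h2 h3
    apply parity_horiz a t hal
    · intro h; exact hq (h.2 this)
    · intro h; exact hq (h.2 (by rwa [segment_symm]))
  have ver : ∀ i j : ℤ, h * j ≤ q.im → q.im ≤ h * (j+1) → q.re = h * i → 
      ps (wt i j) a t a = ps (wt (i-1) j) a t a := by
    intro i j h1 h2 h3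
    have := mem_vert hh h1 h2 h3
    apply parity_vert (fun _ _ h => h.1) a t hal
    · intro h; exact hq (h.2 this)
    · intro h; exact hq (h.2 (by rwa [segment_symm]))
  -- trichotomy
  have tri : ∀ (x : ℝ) (i i' : ℤ), h * i ≤ x → x ≤ h * (i+1) → h * i' ≤ x → x ≤ h * (i' + 1) →
      i' = i ∨ (i' = i + 1 ∧ x = h * (i + 1)) ∨ (i = i' + 1 ∧ x = h * (i' + 1)) := by
    intro x i i' a1 a2 a3 a4
    have b1 : (i : ℝ) ≤ i' + 1 := le_of_mul_le_mul_left (a1.trans a4) hh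
    have b2 : (i' : ℝ) ≤ i + 1 := le_of_mul_le_mul_left (a3.trans a2) hh
    have c1 : i ≤ i' + 1 := by exact_mod_cast b1
    have c2 : i' ≤ i + 1 := by exact_mod_cast b2
    have : i' = i ∨ i' = i + 1 ∨ i = i' + 1 := by omega
    rcases this with r | r | r
    · exact Or.inl r
    · refine Or.inr (Or.inl ⟨r, le_antisymm a2 ?_⟩)
      rw [r] at a3; push_cast at a3; exact a3
    · refine Or.inr (Or.inr ⟨r, le_antisymm a4 ?_⟩)
      rw [r] at a1; push_cast at a1; exact a1
  obtain ⟨a1, a2, a3, a4⟩ := h1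
  obtain ⟨b1, b2, b3, b4⟩ := h2
  -- change the first index, then the second
  have s1 : ps (wt i j) a t a = ps (wt i' j) a t a := by
    rcases tri _ _ _ a1 a2 b1 b2 with r | ⟨r, e⟩ | ⟨r, e⟩
    · rw [r]
    · have := ver (i+1) j a3 a4 (by push_cast; exact e)
      rw [r, this]; simp
    · have := ver (i'+1) j a3 a4 (by push_cast; exact e)
      rw [r, this]; simp
  rw [s1]
  rcases tri _ _ _ a3 a4 b3 b4 with r | ⟨r, e⟩ | ⟨r, e⟩
  · rw [r]
  · have := hor i' (j+1) b1 b2 (by push_cast; exact e)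
    rw [r, this]; simp
  · have := hor i' (j'+1) b1 b2 (by push_cast; exact e)
    rw [r, this]; simp

lemma floor_near {h : ℝ} (hh : 0 < h) (x : ℝ) : ∀ᶠ x' in nhds x, 
    h * ⌊x' / h⌋ ≤ x ∧ x ≤ h * (⌊x' / h⌋ + 1) := by
  have c : Filter.Tendsto (fun x' : ℝ => x' / h) (nhds x) (nhds (x / h)) := by
    apply Continuous.tendsto; fun_prop
  have e1 := c.eventually (gt_mem_nhds (Int.lt_floor_add_one (x/h)))
  have e2 := c.eventually (lt_mem_nhds (show ((⌈x/h⌉ : ℤ) : ℝ) - 1 < x / h by 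
    have := Int.ceil_lt_add_one (x/h); linarith))
  filter_upwards [e1, e2] with x' h1 h2
  constructor
  · have : ⌊x'/h⌋ < ⌊x/h⌋ + 1 := by
      rw [Int.floor_lt]; push_cast; exact h1
    have : ⌊x'/h⌋ ≤ ⌊x/h⌋ := by omega
    have : (⌊x'/h⌋ : ℝ) ≤ x / h := by 
      have h3 : (⌊x'/h⌋ : ℝ) ≤ ⌊x/h⌋ := by exact_mod_cast this
      exact h3.trans (Int.floor_le _)
    rw [le_div_iff₀ hh] at this; linarith
  · have h3 := Int.lt_floor_add_one (x'/h)
    have h4 : ((⌈x/h⌉ : ℤ) : ℝ) < ⌊x'/h⌋ + 2 := by linarith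
    have h5 : ⌈x/h⌉ < ⌊x'/h⌋ + 2 := by exact_mod_cast h4
    have h6 : ⌈x/h⌉ ≤ ⌊x'/h⌋ + 1 := by omega
    have h7 : ((⌈x/h⌉ : ℤ) : ℝ) ≤ ⌊x'/h⌋ + 1 := by exact_mod_cast h6
    have h8 := (Int.le_ceil (x/h)).trans h7
    rw [div_le_iff₀ hh] at h8; linarith

lemma mem_cell_floor {h : ℝ} (hh : 0 < h) (q : ℂ) : q ∈ cell h ⌊q.re / h⌋ ⌊q.im / h⌋ := by
  have a1 := (floor_near hh q.re).self_of_nhds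
  have a2 := (floor_near hh q.im).self_of_nhds
  exact ⟨a1.1, a1.2, a2.1, a2.2⟩

theorem odd_good {h : ℝ} (hh : 0 < h) {W : Set ℂ} (hW : NoIsland Wᶜ) (a : ℤ × ℤ)
    (t : List (ℤ × ℤ)) (hal : al (Rel h W) a t a) (i j : ℤ) (ho : ps (wt i j) a t a ≠ 0) :
    cell h i j ⊆ W := by
  let A : Set ℂ := {q | q ∈ Wᶜ ∧ ps (wt ⌊q.re / h⌋ ⌊q.im / h⌋) a t a ≠ 0}
  have hA : A = ∅ := by
    apply hW A (fun q hq => hq.1)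
    · obtain ⟨M, hM⟩ := parity_bdd (R := Rel h W) (fun _ _ h => h.1) a t hal
      rw [isBounded_iff_forall_norm_le]
      refine ⟨h * (M+1) + h * (M+1), fun q hq => ?_⟩
      obtain ⟨m1, m2⟩ := hM _ _ hq.2
      obtain ⟨c1, c2, c3, c4⟩ := mem_cell_floor hh q
      rw [abs_le] at m1 m2
      have key : ∀ (x : ℝ) (n : ℤ), h * n ≤ x → x ≤ h * (n+1) → (-M ≤ n ∧ n ≤ M) → 
          |x| ≤ h * (M+1) := by
        rintro x n g1 g2 ⟨g3, g4⟩
        have g3' : -(M:ℝ) ≤ n := by exact_mod_cast g3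
        have g4' : (n:ℝ) ≤ M := by exact_mod_cast g4
        rw [abs_le]
        constructor <;> nlinarith
      exact (Complex.norm_le_abs_re_add_abs_im q).trans (add_le_add (key _ _ c1 c2 m1) (key _ _ c3 c4 m2))
    · intro q hq
      have e1 := (Complex.continuous_re.tendsto q).eventually (floor_near hh q.re)
      have e2 := (Complex.continuous_im.tendsto q).eventually (floor_near hh q.im)
      filter_upwards [e1, e2] with q' h1 h2 hq'
      have hs := parity_same hh a t hal hq (mem_cell_floor hh q) 
        (show q ∈ cell h ⌊q'.re / h⌋ ⌊q'.im / h⌋ from ⟨h1.1, h1.2, h2.1, h2.2⟩)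
      simp only [A, Set.mem_ofPred_eq, hs, hq, hq', true_and]
  intro q hq
  by_contra hqW
  have : q ∈ A := ⟨hqW, by rwa [parity_same hh a t hal hqW (mem_cell_floor hh q) hq]⟩
  rw [hA] at this
  exact this

end ArkProof

namespace ArkProof
open CategoryTheory in
lemma exists_Lp (X : Type) [TopologicalSpace X] [PathConnectedSpace X] (x0 : X) :
    ∃ (G : Type) (_ : Group G) (Lp : ∀ a b : X, Path a b → G),
      (∀ a b p q, Path.Homotopic p q → Lp a b p = Lp a b q) ∧
      (∀ a b c p q, Lp a c (p.trans q) = Lp a b p * Lp b c q) ∧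
      (∀ p : Path x0 x0, Lp x0 x0 p = 1 → p.Homotopic (Path.refl x0)) := by
  let τ : ∀ a : X, FundamentalGroupoid.mk x0 ⟶ FundamentalGroupoid.mk a := fun a =>
    Path.Homotopic.Quotient.mk (PathConnectedSpace.somePath x0 a)
  let mh : ∀ {a b : X}, Path a b → (FundamentalGroupoid.mk a ⟶ FundamentalGroupoid.mk b) := fun p =>
    Path.Homotopic.Quotient.mk p
  let Lq : ∀ a b : X, (FundamentalGroupoid.mk a ⟶ FundamentalGroupoid.mk b) → 
    (FundamentalGroup X x0) := fun a b f => τ a ≫ f ≫ inv (τ b)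
  refine ⟨(FundamentalGroup X x0)ᵐᵒᵖ, inferInstance, 
    fun a b p => MulOpposite.op (Lq a b (mh p)), ?_, ?_, ?_⟩
  · intro a b p q h
    have : mh p = mh q := Quotient.sound h
    simp only [this]
  · intro a b c p q
    beta_reduce
    rw [← MulOpposite.op_mul]
    congr 1
    rw [End.mul_def]
    have : mh (p.trans q) = mh p ≫ mh q := rfl
    rw [this]
    simp only [Lq]
    simp only [Category.assoc, IsIso.inv_hom_id_assoc]
  · intro p hp
    have h1 : Lq x0 x0 (mh p) = 1 := by
      simpa using hp
    have h2 : mh p = 𝟙 _ := by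
      rw [End.one_def] at h1
      simp only [Lq] at h1
      rw [← Category.assoc, IsIso.comp_inv_eq, Category.id_comp] at h1
      conv_rhs at h1 => rw [← Category.comp_id (τ x0)]
      exact (cancel_epi _).1 h1
    exact Quotient.exact h2

lemma homotopic_of_convex {W B : Set ℂ} (hB : Convex ℝ B) (hBW : B ⊆ W) {a b : W}
    (p q : Path a b) (hp : ∀ t, (p t : ℂ) ∈ B) (hq : ∀ t, (q t : ℂ) ∈ B) : p.Homotopic q := by
  have hne : B.Nonempty := ⟨_, hp 0⟩
  have := hB.contractibleSpace hne
  have ha : (a : ℂ) ∈ B := by simpa using hp 0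
  have hb : (b : ℂ) ∈ B := by simpa using hp 1
  let P : Path (⟨a, ha⟩ : B) ⟨b, hb⟩ := 
    { toFun := fun t => ⟨p t, hp t⟩, source' := by simp, target' := by simp }
  let Q : Path (⟨a, ha⟩ : B) ⟨b, hb⟩ := 
    { toFun := fun t => ⟨q t, hq t⟩, source' := by simp, target' := by simp }
  have h := SimplyConnectedSpace.paths_homotopic P Q
  have := h.map (⟨Set.inclusion hBW, continuous_inclusion hBW⟩ : C(B, W))
  exact this

/-- segment as a path in `W` -/
noncomputable def segPath {W : Set ℂ} (a b : W) (h : segment ℝ (a : ℂ) b ⊆ W) : Path a b where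
  toFun t := ⟨AffineMap.lineMap (a : ℂ) (b : ℂ) (t : ℝ), h (by
    rw [segment_eq_image_lineMap]; exact ⟨t, t.2, rfl⟩)⟩
  continuous_toFun := by
    apply Continuous.subtype_mk
    exact AffineMap.lineMap_continuous.comp continuous_subtype_val
  source' := by simp
  target' := by simp

lemma exists_E {W : Set ℂ} {G : Type} [Group G] (Lp : ∀ a b : W, Path a b → G)
    (h1 : ∀ a b p q, Path.Homotopic p q → Lp a b p = Lp a b q)
    (h2 : ∀ a b c p q, Lp a c (p.trans q) = Lp a b p * Lp b c q) : 
    ∃ E : ℂ → ℂ → G, 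
      (∀ B ⊆ W, Convex ℝ B → ∀ a ∈ B, ∀ b ∈ B, ∀ c ∈ B, E a b * E b c = E a c) ∧
      (∀ B ⊆ W, Convex ℝ B → ∀ (a b : W) (p : Path a b), (∀ t, (p t : ℂ) ∈ B) → 
        Lp a b p = E a b) := by
  classical
  let E : ℂ → ℂ → G := fun a b => if h : segment ℝ a b ⊆ W then 
    Lp ⟨a, h (left_mem_segment ℝ a b)⟩ ⟨b, h (right_mem_segment ℝ a b)⟩ (segPath _ _ h) else 1
  have seg_mem : ∀ B : Set ℂ, Convex ℝ B → ∀ a b : W, (a : ℂ) ∈ B → (b : ℂ) ∈ B → ∀ h, ∀ t, 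
      (segPath a b h t : ℂ) ∈ B := by
    intro B hB a b ha hb h t
    apply hB.segment_subset ha hb
    rw [segment_eq_image_lineMap]; exact ⟨t, t.2, rfl⟩
  have key : ∀ B ⊆ W, Convex ℝ B → ∀ (a b : W) (p : Path a b), (∀ t, (p t : ℂ) ∈ B) → 
        Lp a b p = E a b := by
    intro B hBW hB a b p hp
    have ha : (a : ℂ) ∈ B := by simpa using hp 0
    have hb : (b : ℂ) ∈ B := by simpa using hp 1
    have hs : segment ℝ (a : ℂ) b ⊆ W := (hB.segment_subset ha hb).trans hBW
    simp only [E, dif_pos hs]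
    exact h1 _ _ _ _ (homotopic_of_convex hB hBW _ _ hp (seg_mem B hB a b ha hb hs))
  refine ⟨E, ?_, key⟩
  intro B hBW hB a ha b hb c hc
  have hab := (hB.segment_subset ha hb).trans hBW
  have hbc := (hB.segment_subset hb hc).trans hBW
  let p := segPath ⟨a, hBW ha⟩ ⟨b, hBW hb⟩ hab
  let q := segPath ⟨b, hBW hb⟩ ⟨c, hBW hc⟩ hbc
  have hp : ∀ t, (p t : ℂ) ∈ B := seg_mem B hB _ _ ha hb _
  have hq : ∀ t, (q t : ℂ) ∈ B := seg_mem B hB _ _ hb hc _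
  have e1 := key B hBW hB _ _ p hp
  have e2 := key B hBW hB _ _ q hq
  have e3 := key B hBW hB _ _ (p.trans q) (by
    intro t
    rw [Path.trans_apply]
    split_ifs
    · exact hp _
    · exact hq _)
  rw [h2, e1, e2] at e3
  exact e3

lemma Lp_cast {X G : Type} [TopologicalSpace X] (Lp : ∀ a b : X, Path a b → G) {a b a' b' : X}
    (p : Path a b) (ha : a' = a) (hb : b' = b) : Lp a' b' (p.cast ha hb) = Lp a b p := by
  subst ha hb; rfl

lemma convex_cell (h : ℝ) (i j : ℤ) : Convex ℝ (cell h i j) := by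
  have : cell h i j = {q : ℂ | h * i ≤ q.re} ∩ {q : ℂ | q.re ≤ h * (i+1)} ∩ 
    ({q : ℂ | h * j ≤ q.im} ∩ {q : ℂ | q.im ≤ h * (j+1)}) := by
    ext q; simp [cell]; tauto
  rw [this]
  exact ((convex_halfSpace_re_ge _).inter (convex_halfSpace_re_le _)).inter 
    ((convex_halfSpace_im_ge _).inter (convex_halfSpace_im_le _))

theorem walk_trivial {h : ℝ} (hh : 0 < h) {W : Set ℂ} (hW : NoIsland Wᶜ) {G : Type} [Group G]
    (E : ℂ → ℂ → G) 
    (hE : ∀ B ⊆ W, Convex ℝ B → ∀ a ∈ B, ∀ b ∈ B, ∀ c ∈ B, E a b * E b c = E a c)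
    (a : ℤ × ℤ) (t : List (ℤ × ℤ)) (hal : al (Rel h W) a t a) : 
    pp (fun p q => E (pt h p) (pt h q)) a t a = 1 := by
  have hself : ∀ z ∈ W, E z z = 1 := by
    intro z hz
    have := hE {z} (by simpa using hz) (convex_singleton z) z rfl z rfl z rfl
    simpa using this
  refine discrete _ (Rel h W) (fun i j => cell h i j ⊆ W) (fun _ _ h => h.1) ?_ ?_ ?_ 
    (fun a t ha i j hij => odd_good hh hW a t ha i j hij) a t hal
  · intro a ha
    exact hself _ (ha.2 (left_mem_segment ℝ _ _))
  · intro a b hab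
    rw [hE _ hab.2 (convex_segment _ _) _ (left_mem_segment ℝ _ _) _ (right_mem_segment ℝ _ _) _ 
      (left_mem_segment ℝ _ _)]
    exact hself _ (hab.2 (left_mem_segment ℝ _ _))
  · intro i j hg
    have m00 : pt h (i, j) ∈ cell h i j := by
      simp only [cell, pt, Set.mem_ofPred_eq]; push_cast; refine ⟨?_, ?_, ?_, ?_⟩ <;> nlinarith
    have m10 : pt h (i+1, j) ∈ cell h i j := by
      simp only [cell, pt, Set.mem_ofPred_eq]; push_cast; refine ⟨?_, ?_, ?_, ?_⟩ <;> nlinarith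
    have m01 : pt h (i, j+1) ∈ cell h i j := by
      simp only [cell, pt, Set.mem_ofPred_eq]; push_cast; refine ⟨?_, ?_, ?_, ?_⟩ <;> nlinarith
    have m11 : pt h (i+1, j+1) ∈ cell h i j := by
      simp only [cell, pt, Set.mem_ofPred_eq]; push_cast; refine ⟨?_, ?_, ?_, ?_⟩ <;> nlinarith
    have cv := convex_cell h i j
    have sub : ∀ a b, pt h a ∈ cell h i j → pt h b ∈ cell h i j → 
      segment ℝ (pt h a) (pt h b) ⊆ W := fun a b ha hb => (cv.segment_subset ha hb).trans hg
    refine ⟨⟨?_, sub _ _ m01 m00⟩, ⟨?_, sub _ _ m00 m01⟩, ⟨?_, sub _ _ m00 m10⟩, 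
      ⟨?_, sub _ _ m10 m00⟩, ?_, ?_⟩
    · simp [Adj]
    · simp [Adj]
    · simp [Adj]
    · simp [Adj]
    · rw [hE _ hg cv _ m01 _ m11 _ m10, hE _ hg cv _ m01 _ m00 _ m10]
    · rw [hE _ hg cv _ m10 _ m11 _ m01, hE _ hg cv _ m10 _ m00 _ m01]

end ArkProof

namespace ArkProof

/-- nearest grid vertex -/
noncomputable def rd (h : ℝ) (z : ℂ) : ℤ × ℤ := (round (z.re / h), round (z.im / h))

lemma round_err {h : ℝ} (hh : 0 < h) (x : ℝ) : |h * round (x / h) - x| ≤ h / 2 := by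
  have h1 := abs_sub_round (x / h)
  have h2 : h * round (x / h) - x = - (h * (x / h - round (x / h))) := by field_simp; ring
  rw [h2, abs_neg, abs_mul, abs_of_pos hh]
  nlinarith

lemma round_near {h : ℝ} (hh : 0 < h) (x y : ℝ) (hxy : |x - y| < h) : 
    round (y / h) = round (x / h) ∨ round (y / h) = round (x / h) + 1 ∨ 
    round (y / h) = round (x / h) - 1 := by
  have h1 := abs_sub_round (x / h)
  have h2 := abs_sub_round (y / h)
  have h3 : |x / h - y / h| < 1 := by
    rw [← sub_div, abs_div, abs_of_pos hh, div_lt_one hh]; exact hxy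
  rw [abs_le] at h1 h2
  rw [abs_lt] at h3
  have h4 : (round (y / h) : ℝ) < round (x/h) + 2 := by linarith
  have h5 : (round (x / h) : ℝ) < round (y/h) + 2 := by linarith
  have h6 : round (y / h) < round (x/h) + 2 := by exact_mod_cast h4
  have h7 : round (x / h) < round (y/h) + 2 := by exact_mod_cast h5
  omega

lemma step_dist {h : ℝ} (hh : 0 < h) (z w : ℂ) (hzw : dist w z < h) :
    pt h (rd h z) ∈ ball z (4 * h) ∧ pt h ((rd h z).1, (rd h w).2) ∈ ball z (4 * h) ∧ 
    pt h (rd h w) ∈ ball z (4 * h) ∧ w ∈ ball z (4 * h) ∧ 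
    Adj (rd h z) ((rd h z).1, (rd h w).2) ∧ Adj ((rd h z).1, (rd h w).2) (rd h w) := by
  have a1 := round_err hh z.re
  have a2 := round_err hh z.im
  have a3 := round_err hh w.re
  have a4 := round_err hh w.im
  rw [dist_eq_norm] at hzw
  have b1 : |w.re - z.re| < h := by
    have := Complex.abs_re_le_norm (w - z); rw [Complex.sub_re] at this; linarith
  have b2 : |w.im - z.im| < h := by
    have := Complex.abs_im_le_norm (w - z); rw [Complex.sub_im] at this; linarith
  have key : ∀ u : ℂ, |u.re - z.re| < 2 * h → |u.im - z.im| < 2 * h → u ∈ ball z (4 * h) := by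
    intro u h1 h2
    rw [mem_ball, dist_eq_norm]
    have := Complex.norm_le_abs_re_add_abs_im (u - z)
    rw [Complex.sub_re, Complex.sub_im] at this
    linarith
  have r1 := round_near hh z.re w.re (by rwa [abs_sub_comm])
  have r2 := round_near hh z.im w.im (by rwa [abs_sub_comm])
  rw [abs_le] at a1 a2 a3 a4
  rw [abs_lt] at b1 b2
  refine ⟨key _ ?_ ?_, key _ ?_ ?_, key _ ?_ ?_, key _ ?_ ?_, ?_, ?_⟩
  any_goals ((try simp only [pt, rd]); rw [abs_lt]; constructor <;> linarith)
  · rcases r2 with r | r | r <;> simp [Adj, rd, r]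
  · rcases r1 with r | r | r <;> simp [Adj, rd, r]

theorem sc_of_noIsland {W : Set ℂ} (hWo : IsOpen W) (hWc : IsPathConnected W)
    (hW : NoIsland Wᶜ) : IsSimplyConnected W := by
  have : PathConnectedSpace W := isPathConnected_iff_pathConnectedSpace.mp hWc
  refine simply_connected_iff_loops_nullhomotopic.mpr ⟨this, ?_⟩
  intro x γ
  obtain ⟨G, _, Lp, h1, h2, h3⟩ := exists_Lp W x
  obtain ⟨E, hE1, hE2⟩ := exists_E Lp h1 h2
  -- a uniform radius
  obtain ⟨h, hh, hball⟩ : ∃ h : ℝ, 0 < h ∧ ∀ t, ball (γ t : ℂ) (4 * h) ⊆ W := by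
    have hK : IsCompact (Set.range fun t => (γ t : ℂ)) := isCompact_range (by fun_prop)
    obtain ⟨δ, hδ, hsub⟩ := hK.exists_thickening_subset_open hWo (by rintro _ ⟨t, rfl⟩; exact (γ t).2)
    refine ⟨δ / 4, by positivity, fun t => ?_⟩
    have : 4 * (δ / 4) = δ := by ring
    rw [this]
    exact (ball_subset_thickening (Set.mem_range_self (f := fun t => (γ t : ℂ)) t) δ).trans hsub
  have huc : UniformContinuous (fun t => (γ t : ℂ)) := 
    CompactSpace.uniformContinuous_of_continuous (by fun_prop)
  obtain ⟨η, hη, hγ⟩ := Metric.uniformContinuous_iff.mp huc h hh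
  obtain ⟨N, hN⟩ := exists_nat_gt (1 / η)
  have hN0 : 0 < (N : ℝ) := lt_trans (by positivity) hN
  let tt : ℕ → unitInterval := fun k => Set.projIcc 0 1 zero_le_one ((k : ℝ) / N)
  have htt : ∀ k ≤ N, ((tt k : unitInterval) : ℝ) = (k : ℝ) / N := by
    intro k hk
    have : (k : ℝ) ≤ N := by exact_mod_cast hk
    simp only [tt]
    rw [Set.projIcc_of_mem]
    exact ⟨by positivity, by rw [div_le_one hN0]; exact this⟩
  have hself : ∀ z ∈ W, E z z = 1 := by
    intro z hz
    have := hE1 {z} (by simpa using hz) (convex_singleton z) z rfl z rfl z rfl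
    simpa using this
  let v : ℕ → ℤ × ℤ := fun k => rd h (γ (tt k))
  have main : ∀ k ≤ N, ∃ l, al (Rel h W) (v 0) l (v k) ∧ 
      Lp _ _ (γ.subpath (tt 0) (tt k)) = E (γ (tt 0)) (pt h (v 0)) * 
        (pp (fun p q => E (pt h p) (pt h q)) (v 0) l (v k) * E (pt h (v k)) (γ (tt k))) := by
    intro k
    induction k with
    | zero => 
      intro _
      obtain ⟨m1, -⟩ := step_dist hh (γ (tt 0)) (γ (tt 0)) (by simpa using hh)
      have hb := hball (tt 0)
      refine ⟨[], ⟨Or.inl rfl, ?_⟩, ?_⟩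
      · rw [segment_same]; simpa using hb m1
      · simp only [pp]
        rw [hself _ (hb m1), one_mul]
        have hc := mem_ball_self (x := (γ (tt 0) : ℂ)) (show 0 < 4 * h by positivity)
        rw [hE1 _ hb (convex_ball _ _) _ hc _ m1 _ hc]
        exact hE2 _ hb (convex_ball _ _) _ _ _ (by simpa using hc)
    | succ k ih =>
      intro hk
      obtain ⟨l, hl, hL⟩ := ih (by omega)
      have hd : ∀ s ∈ Set.Icc (tt k) (tt (k+1)), dist (γ s : ℂ) (γ (tt k)) < h := by
        intro s hs
        apply hγ
        rw [Subtype.dist_eq, Real.dist_eq]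
        have s1 : ((tt k : unitInterval) : ℝ) ≤ s := hs.1
        have s2 : (s : ℝ) ≤ tt (k+1) := hs.2
        rw [htt _ (by omega)] at s1
        rw [htt _ hk] at s2
        rw [htt _ (by omega), abs_of_nonneg (by linarith)]
        have : ((k + 1 : ℕ) : ℝ) / N = k / N + 1 / N := by push_cast; ring
        have : 1 / (N : ℝ) < η := by
          rw [div_lt_comm₀ hN0 hη]; exact hN
        linarith
      have hle : tt k ≤ tt (k+1) := by
        change ((tt k : unitInterval) : ℝ) ≤ (tt (k+1) : unitInterval)
        rw [htt _ (by omega), htt _ hk]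
        gcongr; simp
      obtain ⟨m1, m2, m3, m4, ad1, ad2⟩ := step_dist hh (γ (tt k)) (γ (tt (k+1))) 
        (hd _ ⟨hle, le_rfl⟩)
      have hb := hball (tt k)
      have cv := convex_ball (γ (tt k) : ℂ) (4 * h)
      have m0 := mem_ball_self (x := (γ (tt k) : ℂ)) (show 0 < 4 * h by positivity)
      refine ⟨l ++ v k :: [((v k).1, (v (k+1)).2)], ?_, ?_⟩
      · rw [al_append]
        exact ⟨hl, ⟨ad1, (cv.segment_subset m1 m2).trans hb⟩, 
          ⟨ad2, (cv.segment_subset m2 m3).trans hb⟩⟩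
      · rw [pp_append]
        simp only [pp]
        have e1 := h1 _ _ _ _ ⟨Path.Homotopy.subpathTransSubpath γ (tt 0) (tt k) (tt (k+1))⟩
        rw [← e1, h2, hL]
        have e2 := hE2 _ hb cv _ _ (γ.subpath (tt k) (tt (k+1))) (by
          intro t
          have : γ.subpath (tt k) (tt (k+1)) t ∈ Set.range (γ.subpath (tt k) (tt (k+1))) := ⟨t, rfl⟩
          rw [Path.range_subpath_of_le _ _ _ hle] at this
          obtain ⟨s, hs, hs'⟩ := this
          rw [← hs', mem_ball]
          linarith [hd s hs])
        rw [e2]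
        simp only [mul_assoc]
        congr 2
        rw [hE1 _ hb cv _ m1 _ m0 _ m4, hE1 _ hb cv _ m2 _ m3 _ m4, hE1 _ hb cv _ m1 _ m2 _ m4]
  obtain ⟨l, hl, hL⟩ := main N le_rfl
  have t0 : tt 0 = 0 := by
    apply Subtype.ext; rw [htt 0 (by omega)]; simp
  have t1 : tt N = 1 := by
    apply Subtype.ext; rw [htt N le_rfl]; simp [hN0.ne']
  have hγ01 : γ (tt N) = γ (tt 0) := by rw [t0, t1]; simp
  have hv : v N = v 0 := by simp only [v, hγ01]
  rw [hv] at hl hL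
  rw [walk_trivial hh hW E hE1 _ _ hl, one_mul, show ((γ (tt N) : W) : ℂ) = γ (tt 0) from congrArg _ hγ01] at hL
  have hb := hball (tt 0)
  obtain ⟨m1, -⟩ := step_dist hh (γ (tt 0)) (γ (tt 0)) (by simpa using hh)
  have hc := mem_ball_self (x := (γ (tt 0) : ℂ)) (show 0 < 4 * h by positivity)
  rw [hE1 _ hb (convex_ball _ _) _ hc _ m1 _ hc, hself _ (hb hc)] at hL
  apply h3
  rw [← hL, ← Lp_cast Lp γ γ.source γ.target]
  have e : ∀ s t : unitInterval, s = 0 → t = 1 → 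
      Lp _ _ (γ.cast γ.source γ.target) = Lp _ _ (γ.subpath s t) := by
    rintro _ _ rfl rfl
    rw [Path.subpath_zero_one]
  exact e _ _ t0 t1

end ArkProof

namespace ArkProof

lemma noIsland_of_conn {C : Set ℂ}
    (h : ∀ z ∈ C, ∃ S ⊆ C, z ∈ S ∧ IsPreconnected S ∧ ¬ IsBounded S) : NoIsland C := by
  intro A hAC hAb hloc
  by_contra hne
  obtain ⟨z, hz⟩ := Set.nonempty_iff_ne_empty.mpr hne
  obtain ⟨S, hSC, hzS, hS, hSb⟩ := h z (hAC hz)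
  apply hSb
  apply hAb.subset
  have : PreconnectedSpace S := isPreconnected_iff_preconnectedSpace.mp hS
  have hlc : IsLocallyConstant (fun s : S => ((s : ℂ) ∈ A)) := by
    rw [IsLocallyConstant.iff_eventually_eq]
    intro s
    have := (continuous_subtype_val.tendsto s).eventually (hloc s (hSC s.2))
    filter_upwards [this] with s' hs'
    exact propext (hs' (hSC s'.2))
  intro w hw
  have := hlc.apply_eq_of_preconnectedSpace ⟨z, hzS⟩ ⟨w, hw⟩
  simp only [hz, eq_iff_iff, true_iff] at this
  exact this

lemma noIsland_component {V : Set ℂ} (hV : IsOpen V) (hVi : NoIsland Vᶜ) (z : ℂ) :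
    NoIsland (connectedComponentIn V z)ᶜ := by
  set W := connectedComponentIn V z with hWdef
  have hWo : IsOpen W := hV.connectedComponentIn
  have hWV : W ⊆ V := connectedComponentIn_subset V z
  intro A hAW hAb hloc
  have hA' : A ∩ Vᶜ = ∅ := by
    apply hVi _ Set.inter_subset_right (hAb.subset Set.inter_subset_left)
    intro q hq
    filter_upwards [hloc q (fun h => hq (hWV h))] with q' hq' hq'V
    have := hq' (fun h => hq'V (hWV h))
    simp only [Set.mem_inter_iff, this, hq, hq'V, and_true]
  have hAV : A ⊆ V := by
    intro q hq
    by_contra hqV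
    have : q ∈ A ∩ Vᶜ := ⟨hq, hqV⟩
    rw [hA'] at this; exact this
  have hAo : IsOpen A := by
    rw [isOpen_iff_mem_nhds]
    intro q hq
    have hqo : connectedComponentIn V q ∈ nhds q := 
      hV.connectedComponentIn.mem_nhds (mem_connectedComponentIn (hAV hq))
    filter_upwards [hqo, hloc q (hAW hq)] with q' h1 h2
    refine (h2 ?_).2 hq
    intro h3
    have e1 := connectedComponentIn_eq h1
    have e2 := connectedComponentIn_eq h3
    apply hAW hq
    rw [hWdef, e2, ← e1]
    exact mem_connectedComponentIn (hAV hq)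
  have hAc : IsClosed A := by
    rw [← isOpen_compl_iff, isOpen_iff_mem_nhds]
    intro q hq
    by_cases hqW : q ∈ W
    · filter_upwards [hWo.mem_nhds hqW] with q' h1 h2
      exact hAW h2 h1
    · filter_upwards [hloc q hqW] with q' h1 h2
      exact hq ((h1 (hAW h2)).1 h2)
  rcases isClopen_iff.mp ⟨hAc, hAo⟩ with h | h
  · exact h
  · rw [h] at hAb
    exact absurd hAb (NormedSpace.unbounded_univ ℂ ℂ)

/-- the compact exhaustion used below, `Kn 0` is empty -/
def Kn (n : ℕ) : Set ℂ := closedBall 0 ((n : ℝ) - 1)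

/-- points from which one can escape to infinity avoiding `F ∪ Kn n` -/
def Gn (F : Set ℂ) (n : ℕ) : Set ℂ :=
  {z | z ∈ (F ∪ Kn n)ᶜ ∧ ¬ IsBounded (connectedComponentIn (F ∪ Kn n)ᶜ z)}

lemma exists_radius {F : Set ℂ} (hA : IsArakelian F) : ∃ ρ : ℕ → ℝ, ∀ n z, z ∉ F → ρ n < ‖z‖ → 
    (n : ℝ) < ‖z‖ ∧ z ∈ Gn F n := by
  have : ∀ n : ℕ, ∃ r : ℝ, ∀ z, z ∉ F → r < ‖z‖ → (n : ℝ) < ‖z‖ ∧ z ∈ Gn F n := by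
    intro n
    obtain ⟨r, hr⟩ := isBounded_iff_forall_norm_le.mp (hA.2 (Kn n) (isCompact_closedBall _ _))
    refine ⟨max r n, fun z hz hrz => ?_⟩
    rw [max_lt_iff] at hrz
    have hzc : z ∈ (F ∪ Kn n)ᶜ := by
      rintro (h | h)
      · exact hz h
      · simp only [Kn, mem_closedBall_zero_iff] at h
        linarith
    refine ⟨hrz.2, hzc, fun hb => ?_⟩
    exact absurd (hr z ⟨hzc, hb⟩) (not_le.mpr hrz.1)
  choose ρ hρ using this
  exact ⟨ρ, hρ⟩

lemma exists_step {F : Set ℂ} (hF : IsClosed F) (hA : IsArakelian F) (n : ℕ) (z : ℂ) 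
    (hz : z ∈ Gn F n) : ∃ w, w ∈ Gn F (n+1) ∧ JoinedIn (F ∪ Kn n)ᶜ z w := by
  obtain ⟨ρ, hρ⟩ := exists_radius hA
  obtain ⟨w, hw, hwρ⟩ : ∃ w ∈ connectedComponentIn (F ∪ Kn n)ᶜ z, ρ (n+1) < ‖w‖ := by
    by_contra! hcon
    exact hz.2 (isBounded_iff_forall_norm_le.mpr ⟨_, hcon⟩)
  have hwc := connectedComponentIn_subset _ _ hw
  have ho : IsOpen (F ∪ Kn n)ᶜ := (hF.union isClosed_closedBall).isOpen_compl
  refine ⟨w, (hρ (n+1) w (fun h => hwc (Or.inl h)) hwρ).2, ?_⟩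
  have hpc : IsPathConnected (connectedComponentIn (F ∪ Kn n)ᶜ z) := 
    (ho.connectedComponentIn).isConnected_iff_isPathConnected.mp 
      (isConnected_connectedComponentIn_iff.mpr hz.1)
  exact (hpc.joinedIn z (mem_connectedComponentIn hz.1) w hw).mono (connectedComponentIn_subset _ _)

lemma exists_ray {F : Set ℂ} (hF : IsClosed F) (hA : IsArakelian F) (n : ℕ) (z : ℂ) 
    (hz : z ∈ Gn F n) : ∃ S : Set ℂ, z ∈ S ∧ IsClosed S ∧ IsPreconnected S ∧ ¬ IsBounded S ∧ 
      Disjoint S (F ∪ Kn n) := by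
  choose nx hnx1 hnx2 using exists_step hF hA
  let u : (k : ℕ) → {w // w ∈ Gn F (n + k)} := fun k =>
    Nat.rec ⟨z, hz⟩ (fun k w => ⟨nx (n+k) w.1 w.2, hnx1 (n+k) w.1 w.2⟩) k
  have hj : ∀ k, JoinedIn (F ∪ Kn (n+k))ᶜ (u k).1 (u (k+1)).1 := fun k => hnx2 (n+k) _ (u k).2
  let P : ℕ → Set ℂ := fun k => Set.range (hj k).somePath
  have hP : ∀ k, P k ⊆ (F ∪ Kn (n+k))ᶜ := by
    rintro k _ ⟨t, rfl⟩; exact (hj k).somePath_mem t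
  have hu1 : ∀ k, (u k).1 ∈ P k := fun k => ⟨0, by simp⟩
  have hu2 : ∀ k, (u (k+1)).1 ∈ P k := fun k => ⟨1, by simp⟩
  refine ⟨⋃ k, P k, Set.mem_iUnion.mpr ⟨0, hu1 0⟩, ?_, ?_, ?_, ?_⟩
  · apply LocallyFinite.isClosed_iUnion
    · intro x
      obtain ⟨m, hm⟩ := exists_nat_gt ‖x‖
      refine ⟨ball 0 m, isOpen_ball.mem_nhds (by simpa using hm), ?_⟩
      apply (Set.finite_lt_nat (m+1)).subset
      rintro k ⟨y, hy1, hy2⟩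
      by_contra hk
      apply hP k hy1
      right
      simp only [Set.mem_ofPred_eq, not_lt] at hk
      have : ((m : ℝ) + 1) ≤ k := by exact_mod_cast hk
      simp only [Kn, mem_closedBall_zero_iff, Nat.cast_add]
      rw [mem_ball_zero_iff] at hy2
      have : (0 : ℝ) ≤ n := by positivity
      linarith
    · intro k
      exact (isCompact_range (hj k).somePath.continuous).isClosed
  · apply IsPreconnected.iUnion_of_chain
    · intro k
      exact isPreconnected_range (hj k).somePath.continuous
    · intro k
      exact ⟨_, hu2 k, hu1 (k+1)⟩
  · intro hb
    obtain ⟨r, hr⟩ := isBounded_iff_forall_norm_le.mp hb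
    obtain ⟨m, hm⟩ := exists_nat_gt (r + 1)
    have h1 := hr _ (Set.mem_iUnion.mpr ⟨m, hu1 m⟩)
    apply hP m (hu1 m)
    right
    simp only [Kn, mem_closedBall_zero_iff, Nat.cast_add]
    have : (0 : ℝ) ≤ n := by positivity
    linarith
  · rw [Set.disjoint_iUnion_left]
    intro k
    refine (Set.subset_compl_iff_disjoint_right.mp (hP k)).mono_right ?_
    apply Set.union_subset_union_right
    apply closedBall_subset_closedBall
    push_cast
    have : (0 : ℝ) ≤ k := by positivity
    linarith

lemma exists_ray' {F : Set ℂ} (hF : IsClosed F) (hA : IsArakelian F) (z : ℂ) (hz : z ∉ F) : 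
    ∃ S : Set ℂ, z ∈ S ∧ IsClosed S ∧ IsPreconnected S ∧ ¬ IsBounded S ∧ 
      Disjoint S F ∧ ∀ n : ℕ, (n : ℝ) < ‖z‖ ∧ z ∈ Gn F n → Disjoint S (Kn n) := by
  classical
  have h0 : z ∈ Gn F 0 := by
    have : Kn 0 = ∅ := by simp [Kn]
    simp only [Gn, this, Set.union_empty]
    exact ⟨hz, hA.1 z hz⟩
  set m := Nat.findGreatest (fun n => z ∈ Gn F n) ⌈‖z‖⌉₊ with hm
  have hmz : z ∈ Gn F m := Nat.findGreatest_spec (P := fun n => z ∈ Gn F n) (Nat.zero_le _) h0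
  obtain ⟨S, h1, h2, h3, h4, h5⟩ := exists_ray hF hA m z hmz
  rw [Set.disjoint_union_right] at h5
  refine ⟨S, h1, h2, h3, h4, h5.1, ?_⟩
  rintro n ⟨hn, hn'⟩
  have hnm : n ≤ m := by
    apply Nat.le_findGreatest _ hn'
    have := hn.trans_le (Nat.le_ceil _)
    exact_mod_cast this.le
  refine h5.2.mono_right ?_
  apply closedBall_subset_closedBall
  have : (n : ℝ) ≤ m := by exact_mod_cast hnm
  linarith

theorem exists_nbhd {F : Set ℂ} (hF : IsClosed F) (hA : IsArakelian F) {U : Set ℂ} (hU : IsOpen U)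
    (hFU : F ⊆ U) : ∃ V : Set ℂ, IsOpen V ∧ F ⊆ V ∧ V ⊆ U ∧ NoIsland Vᶜ := by
  obtain ⟨ρ, hρ⟩ := exists_radius hA
  choose! S s1 s2 s3 s4 s5 s6 using exists_ray' hF hA
  have hε : ∀ z, z ∉ F → ∃ ε : ℝ, 0 < ε ∧ ε ≤ 1 ∧ closedBall z ε ⊆ Fᶜ := by
    intro z hz
    obtain ⟨ε, h1, h2⟩ := Metric.nhds_basis_closedBall.mem_iff.mp (hF.isOpen_compl.mem_nhds hz)
    exact ⟨min ε 1, by positivity, min_le_right _ _, 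
      (closedBall_subset_closedBall (min_le_left _ _)).trans h2⟩
  choose! ε e1 e2 e3 using hε
  have hUF : ∀ z ∈ Uᶜ, z ∉ F := fun z hz h => hz (hFU h)
  let T : ℕ → Set ℂ := fun n => Uᶜ ∩ (closedBall 0 ((n : ℝ) + 1) \ ball 0 n)
  have hT : ∀ n, IsCompact (T n) := fun n => 
    ((isCompact_closedBall _ _).diff isOpen_ball).inter_left hU.isClosed_compl
  have hcov : ∀ n, ∃ t : Finset ℂ, (∀ x ∈ t, x ∈ T n) ∧ T n ⊆ ⋃ x ∈ t, ball x (ε x) := by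
    intro n
    exact (hT n).elim_nhds_subcover (fun x => ball x (ε x)) 
      (fun x hx => ball_mem_nhds x (e1 x (hUF x hx.1)))
  choose t ht1 ht2 using hcov
  let D : ℕ → Set ℂ := fun n => ⋃ x ∈ t n, (closedBall x (ε x) ∪ S x)
  have htF : ∀ n, ∀ x ∈ t n, x ∉ F := fun n x hx => hUF x (ht1 n x hx).1
  have hDc : IsClosed (⋃ n, D n) := by
    apply LocallyFinite.isClosed_iUnion
    · intro x
      obtain ⟨m, hm⟩ := exists_nat_gt ‖x‖
      obtain ⟨M, hM⟩ := exists_nat_gt (max ((m : ℝ) + 1) (ρ (m + 1)))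
      rw [max_lt_iff] at hM
      refine ⟨ball 0 m, isOpen_ball.mem_nhds (by simpa using hm), ?_⟩
      apply (Set.finite_lt_nat M).subset
      rintro n ⟨y, hy1, hy2⟩
      rw [mem_ball_zero_iff] at hy2
      obtain ⟨w, hw, hyw⟩ := Set.mem_iUnion₂.mp hy1
      have hwT := ht1 n w hw
      have hwF := htF n w hw
      have hnw : (n : ℝ) ≤ ‖w‖ := by
        have := hwT.2.2
        simpa using this
      have : (n : ℝ) < M := by
        rcases hyw with h | h
        · rw [mem_closedBall, dist_comm] at h
          have h1 : ‖w‖ ≤ ‖y‖ + dist w y := by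
            rw [dist_eq_norm]
            have := norm_add_le y (w - y)
            simpa using this
          have := e2 w hwF
          linarith
        · by_contra hcon
          have hlt : ρ (m+1) < ‖w‖ := by linarith
          refine Set.disjoint_left.mp (s6 w hwF (m+1) (hρ (m+1) w hwF hlt)) h ?_
          simp only [Kn, mem_closedBall_zero_iff]
          push_cast
          linarith
      exact_mod_cast this
    · intro n
      apply Set.Finite.isClosed_biUnion (t n).finite_toSet
      intro x hx
      exact isClosed_closedBall.union (s2 x (htF n x hx))
  refine ⟨(⋃ n, D n)ᶜ, hDc.isOpen_compl, ?_, ?_, ?_⟩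
  · intro z hz hzD
    obtain ⟨n, hn⟩ := Set.mem_iUnion.mp hzD
    obtain ⟨x, hx, h⟩ := Set.mem_iUnion₂.mp hn
    rcases h with h | h
    · exact e3 x (htF n x hx) h hz
    · exact Set.disjoint_left.mp (s5 x (htF n x hx)) h hz
  · intro z hz
    by_contra hzU
    apply hz
    have hzT : z ∈ T ⌊‖z‖⌋₊ := by
      refine ⟨hzU, ?_, ?_⟩
      · rw [mem_closedBall_zero_iff]; exact (Nat.lt_floor_add_one _).le
      · rw [mem_ball_zero_iff, not_lt]; exact Nat.floor_le (norm_nonneg _)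
    obtain ⟨x, hx, h⟩ := Set.mem_iUnion₂.mp (ht2 _ hzT)
    exact Set.mem_iUnion.mpr ⟨_, Set.mem_iUnion₂.mpr ⟨x, hx, Or.inl (ball_subset_closedBall h)⟩⟩
  · rw [compl_compl]
    apply noIsland_of_conn
    intro z hz
    obtain ⟨n, hn⟩ := Set.mem_iUnion.mp hz
    obtain ⟨x, hx, h⟩ := Set.mem_iUnion₂.mp hn
    have hxF := htF n x hx
    refine ⟨closedBall x (ε x) ∪ S x, ?_, h, ?_, ?_⟩
    · intro y hy
      exact Set.mem_iUnion.mpr ⟨n, Set.mem_iUnion₂.mpr ⟨x, hx, hy⟩⟩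
    · exact IsPreconnected.union x (mem_closedBall_self (e1 x hxF).le) (s1 x hxF) 
        (convex_closedBall x _).isPreconnected (s3 x hxF)
    · intro hb
      exact s4 x hxF (hb.subset Set.subset_union_right)

end ArkProof

theorem arakelian_extension_and_lift (F : Set ℂ) (hF : IsClosed F)
    (hA : IsArakelian F) (f : ℂ → ℂ) (hfc : ContinuousOn f F)
    (hfd : DifferentiableOn ℂ f (interior F)) (hfz : ∀ z ∈ F, f z ≠ 0) :
    ∃ V : Set ℂ, IsOpen V ∧ F ⊆ V ∧
      (∀ z ∈ V, SimplyConnectedSpace (connectedComponentIn V z)) ∧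
      ∃ ftilde : ℂ → ℂ, Continuous ftilde ∧ (∀ z ∈ F, ftilde z = f z) ∧
        (∀ z ∈ V, ftilde z ≠ 0) ∧
        ∃ gtilde : ℂ → ℂ, ContinuousOn gtilde V ∧
          ∀ z ∈ V, Complex.exp (gtilde z) = ftilde z := by
  obtain ⟨ft, hft⟩ := ContinuousMap.exists_restrict_eq hF
    (⟨F.domRestrict f, hfc.domRestrict⟩ : C(F, ℂ))
  have hfeq : ∀ z ∈ F, ft z = f z := fun z hz => by
    have := congrArg (fun g : C(F, ℂ) => g ⟨z, hz⟩) hft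
    exact this
  obtain ⟨V, hVo, hFV, hVU, hVi⟩ := ArkProof.exists_nbhd hF hA
    (U := {z | ft z ≠ 0}) (isOpen_ne_fun ft.continuous continuous_const)
    (fun z hz => by simpa [hfeq z hz] using hfz z hz)
  have hsc : ∀ z ∈ V, IsSimplyConnected (connectedComponentIn V z) := by
    intro z hz
    refine ArkProof.sc_of_noIsland hVo.connectedComponentIn ?_ 
      (ArkProof.noIsland_component hVo hVi z)
    exact (hVo.connectedComponentIn).isConnected_iff_isPathConnected.mp 
      (isConnected_connectedComponentIn_iff.mpr hz)
  refine ⟨V, hVo, hFV, fun z hz => (hsc z hz).simplyConnectedSpace, ft, ft.continuous, hfeq,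
    fun z hz => hVU hz, ?_⟩
  have hlog : ∀ B : Set ℂ, ∃ g : ℂ → ℂ, (∃ z ∈ V, B = connectedComponentIn V z) →
      ContinuousOn g B ∧ Set.EqOn (Complex.exp ∘ g) ft B := by
    intro B
    by_cases hB : ∃ z ∈ V, B = connectedComponentIn V z
    · obtain ⟨z, hz, rfl⟩ := hB
      obtain ⟨g, hg⟩ := Complex.exists_continuousOn_eqOn_exp_comp (hsc z hz) hVo.connectedComponentIn
        (g := ft) ft.continuous.continuousOn (by
          rintro ⟨w, hw, hw0⟩
          exact hVU (connectedComponentIn_subset _ _ hw) hw0)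
      exact ⟨g, fun _ => hg⟩
    · exact ⟨0, fun h => absurd h hB⟩
  choose g hg using hlog
  refine ⟨fun z => g (connectedComponentIn V z) z, ?_, ?_⟩
  · intro z hz
    have hmem := hVo.connectedComponentIn.mem_nhds (mem_connectedComponentIn hz)
    have h1 := (hg _ ⟨z, hz, rfl⟩).1.continuousAt hmem
    refine (h1.congr ?_).continuousWithinAt
    filter_upwards [hmem] with w hw
    rw [connectedComponentIn_eq hw]
  · intro z hz
    exact (hg _ ⟨z, hz, rfl⟩).2 (mem_connectedComponentIn hz)
end
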